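/- arXiv:1407.1750 — 2 statements merged into one kernel-verified Lean document; each statement's English description precedes it below -/
import Mathlib

section
/- Let M and N be Lie superalgebras over a commutative unital ring K acting compatibly on each other. Then there is a natural isomorphism of Lie superalgebras M ⊗ N ≅ (M ⊗_K N)/D(M,N), where M ⊗_K N is the tensor product of the underlying supermodules and D(M,N) is the submodule generated by the elements (for homogeneous m,m′,m″ ∈ M, n,n′,n″ ∈ N): (i) [m,m′]⊗n − m⊗(^{m′}n) + (−1)^{|m||m′|}(m′⊗ᵐn); (ii) m⊗[n,n′] − (−1)^{|n′|(|m|+|n|)}(^{n′}m⊗n) + (−1)^{|m||n|}(ⁿm⊗n′); (iii) (ⁿm)⊗(ᵐn) with |m| = |n|; (iv) (−1)^{|m||n|}(ⁿm)⊗(^{m′}n′) + (−1)^{(|m|+|n|)(|m′|+|n′|)+|m′||n′|}(^{n′}m′)⊗(ᵐn); (v) the cyclic sum over (m,n),(m′,n′),(m″,n″) of (−1)^{(|m|+|n|)(|m″|+|n″|)+|m||n|+|m′||n′|}[ⁿm, ^{n′}m′]⊗(^{m″}n″); the Lie bracket on the quotient is [m⊗n, m′⊗n′] = −(−1)^{|m||n|}(ⁿm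 ⊗ ^{m′}n′). -/
open scoped TensorProduct

namespace SuperNA

/-- The sign `(-1)^(|α||β|)` appearing in super-algebra identities. -/
def ssign (α β : ZMod 2) : ℤ := (-1 : ℤ) ^ (α.val * β.val)

/-- A Lie superalgebra over a commutative unital ring `K`: a `ℤ/2`-graded `K`-module
with a bilinear bracket satisfying the graded skew-symmetry, the graded Jacobi
(Leibniz form) identity, and `[x₀,x₀] = 0` for even `x₀`. -/
structure LieSuperalgebra (K : Type) [CommRing K] : Type 1 where
  carrier : Type
  [isAddCommGroup : AddCommGroup carrier]
  [isModule : Module K carrier]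
  grading : ZMod 2 → Submodule K carrier
  isInternal : DirectSum.IsInternal grading
  bracket : carrier →ₗ[K] carrier →ₗ[K] carrier
  bracket_grading : ∀ (α β : ZMod 2) (x y : carrier),
    x ∈ grading α → y ∈ grading β → bracket x y ∈ grading (α + β)
  super_skew : ∀ (α β : ZMod 2) (x y : carrier), x ∈ grading α → y ∈ grading β →
    bracket x y = -(ssign α β • bracket y x)
  super_jacobi : ∀ (α β : ZMod 2) (x y : carrier), x ∈ grading α → y ∈ grading β →
    ∀ z : carrier, bracket x (bracket y z)
      = bracket (bracket x y) z + ssign α β • bracket y (bracket x z)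
  bracket_self_even : ∀ x ∈ grading 0, bracket x x = 0

attribute [instance] LieSuperalgebra.isAddCommGroup LieSuperalgebra.isModule

variable {K : Type} [CommRing K]

instance : CoeSort (LieSuperalgebra K) Type := ⟨LieSuperalgebra.carrier⟩

/-- A homomorphism of Lie superalgebras: an even linear map preserving brackets. -/
structure LieSuperHom (L M : LieSuperalgebra K) where
  toLinear : L.carrier →ₗ[K] M.carrier
  map_grading : ∀ (α : ZMod 2), ∀ x ∈ L.grading α, toLinear x ∈ M.grading α
  map_bracket : ∀ x y, toLinear (L.bracket x y) = M.bracket (toLinear x) (toLinear y)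

/-- An action of the Lie superalgebra `P` on the Lie superalgebra `M`. -/
structure LieSuperAction (P M : LieSuperalgebra K) where
  act : P.carrier →ₗ[K] M.carrier →ₗ[K] M.carrier
  act_grading : ∀ (α β : ZMod 2) (p : P.carrier) (m : M.carrier),
    p ∈ P.grading α → m ∈ M.grading β → act p m ∈ M.grading (α + β)
  act_bracket : ∀ (α β : ZMod 2) (p p' : P.carrier), p ∈ P.grading α → p' ∈ P.grading β →
    ∀ m : M.carrier, act (P.bracket p p') m = act p (act p' m) - ssign α β • act p' (act p m)
  act_super_der : ∀ (α β : ZMod 2) (p : P.carrier) (m : M.carrier),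
    p ∈ P.grading α → m ∈ M.grading β → ∀ m' : M.carrier,
    act p (M.bracket m m') = M.bracket (act p m) m' + ssign α β • M.bracket m (act p m')

/-- Two mutual actions are compatible. -/
structure AreCompatible {M N : LieSuperalgebra K}
    (aMN : LieSuperAction M N) (aNM : LieSuperAction N M) : Prop where
  compat_left : ∀ (α β : ZMod 2) (m : M.carrier) (n : N.carrier),
    m ∈ M.grading α → n ∈ N.grading β → ∀ n' : N.carrier,
    aMN.act (aNM.act n m) n' = -(ssign α β • N.bracket (aMN.act m n) n')
  compat_right : ∀ (α β : ZMod 2) (m : M.carrier) (n : N.carrier),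
    m ∈ M.grading α → n ∈ N.grading β → ∀ m' : M.carrier,
    aNM.act (aMN.act m n) m' = -(ssign α β • M.bracket (aNM.act n m) m')

/-- A crossed module of Lie superalgebras `∂ : M → P`. -/
structure CrossedModule (M P : LieSuperalgebra K) where
  act : LieSuperAction P M
  d : LieSuperHom M P
  cm_act : ∀ (p : P.carrier) (m : M.carrier), d.toLinear (act.act p m) = P.bracket p (d.toLinear m)
  cm_peiffer : ∀ (m m' : M.carrier), act.act (d.toLinear m) m' = M.bracket m m'

/-- A morphism of crossed `P`-modules. -/
structure CMHom {P M N : LieSuperalgebra K} (cmM : CrossedModule M P) (cmN : CrossedModule N P) where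
  hom : LieSuperHom M N
  equivariant : ∀ (p : P.carrier) (m : M.carrier),
    hom.toLinear (cmM.act.act p m) = cmN.act.act p (hom.toLinear m)
  comm : ∀ m : M.carrier, cmN.d.toLinear (hom.toLinear m) = cmM.d.toLinear m

/-- The data of a family of "tensor symbols" in a Lie superalgebra `Q`, indexed by pairs of
homogeneous elements of `M` and `N`, satisfying the defining relations of the non-abelian
tensor product `M ⊗ N`. -/
structure TensorData {M N : LieSuperalgebra K}
    (aMN : LieSuperAction M N) (aNM : LieSuperAction N M) (Q : LieSuperalgebra K) where
  pair : (α β : ZMod 2) → M.grading α → N.grading β → Q.carrier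
  pair_grading : ∀ (α β : ZMod 2) (m : M.grading α) (n : N.grading β),
    pair α β m n ∈ Q.grading (α + β)
  pair_smul_left : ∀ (α β : ZMod 2) (c : K) (m : M.grading α) (n : N.grading β),
    pair α β (c • m) n = c • pair α β m n
  pair_smul_right : ∀ (α β : ZMod 2) (c : K) (m : M.grading α) (n : N.grading β),
    pair α β m (c • n) = c • pair α β m n
  pair_add_left : ∀ (α β : ZMod 2) (m m' : M.grading α) (n : N.grading β),
    pair α β (m + m') n = pair α β m n + pair α β m' n
  pair_add_right : ∀ (α β : ZMod 2) (m : M.grading α) (n n' : N.grading β),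
    pair α β m (n + n') = pair α β m n + pair α β m n'
  pair_bracket_left : ∀ (α α' β : ZMod 2) (m : M.grading α) (m' : M.grading α') (n : N.grading β),
    pair (α + α') β ⟨M.bracket m.1 m'.1, M.bracket_grading α α' m.1 m'.1 m.2 m'.2⟩ n
      = pair α (α' + β) m ⟨aMN.act m'.1 n.1, aMN.act_grading α' β m'.1 n.1 m'.2 n.2⟩
        - ssign α α' • pair α' (α + β) m' ⟨aMN.act m.1 n.1, aMN.act_grading α β m.1 n.1 m.2 n.2⟩
  pair_bracket_right : ∀ (α β β' : ZMod 2) (m : M.grading α) (n : N.grading β) (n' : N.grading β'),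
    pair α (β + β') m ⟨N.bracket n.1 n'.1, N.bracket_grading β β' n.1 n'.1 n.2 n'.2⟩
      = ssign β' (α + β) • pair (β' + α) β
          ⟨aNM.act n'.1 m.1, aNM.act_grading β' α n'.1 m.1 n'.2 m.2⟩ n
        - ssign α β • pair (β + α) β'
          ⟨aNM.act n.1 m.1, aNM.act_grading β α n.1 m.1 n.2 m.2⟩ n'
  pair_bracket_pair : ∀ (α β α' β' : ZMod 2) (m : M.grading α) (n : N.grading β)
      (m' : M.grading α') (n' : N.grading β'),
    Q.bracket (pair α β m n) (pair α' β' m' n')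
      = -(ssign α β • pair (β + α) (α' + β')
          ⟨aNM.act n.1 m.1, aNM.act_grading β α n.1 m.1 n.2 m.2⟩
          ⟨aMN.act m'.1 n'.1, aMN.act_grading α' β' m'.1 n'.1 m'.2 n'.2⟩)

/-- `(T, ι)` is *the* non-abelian tensor product `M ⊗ N`: it is initial among Lie
superalgebras equipped with tensor symbols satisfying the defining relations.  This
universal property characterizes the Lie superalgebra presented by the generators
`m ⊗ n` and the relations of the non-abelian tensor product, uniquely up to isomorphism. -/
def IsNATensor {M N : LieSuperalgebra K} (aMN : LieSuperAction M N) (aNM : LieSuperAction N M)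
    (T : LieSuperalgebra K) (ι : TensorData aMN aNM T) : Prop :=
  ∀ (Q : LieSuperalgebra K) (d : TensorData aMN aNM Q),
    ∃! f : LieSuperHom T Q,
      ∀ (α β : ZMod 2) (m : M.grading α) (n : N.grading β),
        f.toLinear (ι.pair α β m n) = d.pair α β m n

/-- Tensor-symbol data additionally satisfying the relations of the non-abelian
exterior square `L ∧ L` (relative to an action `a` of `L` on itself). -/
structure ExtSqData {L : LieSuperalgebra K} (a : LieSuperAction L L) (Q : LieSuperalgebra K)
    extends TensorData a a Q where
  pair_alt : ∀ (α β : ZMod 2) (x : L.grading α) (y : L.grading β),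
    toTensorData.pair α β x y + ssign α β • toTensorData.pair β α y x = 0
  pair_self : ∀ x : L.grading 0, toTensorData.pair 0 0 x x = 0

/-- `(E, ι)` is the non-abelian exterior square `L ∧ L`. -/
def IsNAExtSq {L : LieSuperalgebra K} (a : LieSuperAction L L) (E : LieSuperalgebra K)
    (ι : ExtSqData a E) : Prop :=
  ∀ (Q : LieSuperalgebra K) (d : ExtSqData a Q),
    ∃! f : LieSuperHom E Q,
      ∀ (α β : ZMod 2) (x : L.grading α) (y : L.grading β),
        f.toLinear (ι.pair α β x y) = d.pair α β x y

/-- Generating family for a free Lie superalgebra on a graded set. -/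
structure FreeData (X : Type) (degX : X → ZMod 2) (F : LieSuperalgebra K) where
  gen : X → F.carrier
  gen_grading : ∀ x, gen x ∈ F.grading (degX x)

/-- `F` (with generators `i`) is the free Lie superalgebra on the graded set `(X, degX)`. -/
def IsFreeLieSuper {X : Type} (degX : X → ZMod 2) (F : LieSuperalgebra K)
    (i : FreeData X degX F) : Prop :=
  ∀ (M : LieSuperalgebra K) (j : FreeData X degX M),
    ∃! h : LieSuperHom F M, ∀ x, h.toLinear (i.gen x) = j.gen x

/-- The submodule spanned by brackets `[S, T]`. -/
def bracketSpan (L : LieSuperalgebra K) (S T : Submodule K L.carrier) :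
    Submodule K L.carrier :=
  Submodule.span K {z | ∃ x ∈ S, ∃ y ∈ T, z = L.bracket x y}

/-- Lower central series of a (sub-)Lie superalgebra `S ⊆ L`: `lcs 0 = S`,
`lcs (n+1) = [S, lcs n]`.  `S` is nilpotent of class `≤ c` iff `lcs c = ⊥`. -/
def lcs (L : LieSuperalgebra K) (S : Submodule K L.carrier) : ℕ → Submodule K L.carrier
  | 0 => S
  | n + 1 => bracketSpan L S (lcs L S n)

/-- Derived series of `S ⊆ L`.  `S` is solvable of derived length `≤ c` iff `ds c = ⊥`. -/
def ds (L : LieSuperalgebra K) (S : Submodule K L.carrier) : ℕ → Submodule K L.carrier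
  | 0 => S
  | n + 1 => bracketSpan L (ds L S n) (ds L S n)

/-- `S ⊆ L` is `n`-Engel: `ad(x)ⁿ = 0` on `S` for every `x ∈ S`. -/
def IsEngel (L : LieSuperalgebra K) (S : Submodule K L.carrier) (n : ℕ) : Prop :=
  ∀ x ∈ S, ∀ y ∈ S, ((L.bracket x) ^ n) y = 0

section Grading

variable {V W : Type} [AddCommGroup V] [Module K V] [AddCommGroup W] [Module K W]

/-- The induced grading on a submodule. -/
def gradeSub (g : ZMod 2 → Submodule K V) (S : Submodule K V) : ZMod 2 → Submodule K S :=
  fun α => (g α).comap S.subtype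

/-- The induced grading on a quotient module. -/
def gradeQuot (g : ZMod 2 → Submodule K V) (S : Submodule K V) : ZMod 2 → Submodule K (V ⧸ S) :=
  fun α => (g α).map S.mkQ

/-- The induced grading on a tensor product of supermodules. -/
def gradeTensor (gV : ZMod 2 → Submodule K V) (gW : ZMod 2 → Submodule K W) :
    ZMod 2 → Submodule K (V ⊗[K] W) :=
  fun γ => Submodule.span K {t | ∃ (α β : ZMod 2) (v : V) (w : W),
    α + β = γ ∧ v ∈ gV α ∧ w ∈ gW β ∧ t = v ⊗ₜ[K] w}

/-- A linear equivalence is an isomorphism of supermodules for the given gradings. -/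
def SuperEquiv (gV : ZMod 2 → Submodule K V) (gW : ZMod 2 → Submodule K W)
    (e : V ≃ₗ[K] W) : Prop :=
  ∀ α, (gV α).map e.toLinearMap = gW α

end Grading

/-- An associative (unital) superalgebra over `K`. -/
structure AssocSuperalgebra (K : Type) [CommRing K] : Type 1 where
  carrier : Type
  [isRing : Ring carrier]
  [isAlgebra : Algebra K carrier]
  grading : ZMod 2 → Submodule K carrier
  isInternal : DirectSum.IsInternal grading
  grading_mul : ∀ (α β : ZMod 2) (x y : carrier),
    x ∈ grading α → y ∈ grading β → x * y ∈ grading (α + β)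
  one_mem : (1 : carrier) ∈ grading 0

attribute [instance] AssocSuperalgebra.isRing AssocSuperalgebra.isAlgebra

/-- A (not necessarily unital) associative superalgebra over `K`. -/
structure NuAssocSuperalgebra (K : Type) [CommRing K] : Type 1 where
  carrier : Type
  [isRing : NonUnitalRing carrier]
  [isModule : Module K carrier]
  [isTower : IsScalarTower K carrier carrier]
  [isComm : SMulCommClass K carrier carrier]
  grading : ZMod 2 → Submodule K carrier
  isInternal : DirectSum.IsInternal grading
  grading_mul : ∀ (α β : ZMod 2) (x y : carrier),
    x ∈ grading α → y ∈ grading β → x * y ∈ grading (α + β)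

attribute [instance] NuAssocSuperalgebra.isRing NuAssocSuperalgebra.isModule
  NuAssocSuperalgebra.isTower NuAssocSuperalgebra.isComm

/-- The super-alternating relations inside `L ⊗ L`, whose quotient is `Λ²(L)`. -/
def altRel (L : LieSuperalgebra K) : Submodule K (L.carrier ⊗[K] L.carrier) :=
  Submodule.span K {t | ∃ (α β : ZMod 2) (x : L.grading α) (y : L.grading β),
    t = x.1 ⊗ₜ[K] y.1 + ssign α β • (y.1 ⊗ₜ[K] x.1)}

/-- The super-alternating relations inside `L ⊗ (L ⊗ L)`, whose quotient is `Λ³(L)`. -/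
def altRel3 (L : LieSuperalgebra K) :
    Submodule K (L.carrier ⊗[K] (L.carrier ⊗[K] L.carrier)) :=
  Submodule.span K
    ({t | ∃ (x : L.carrier) (r : L.carrier ⊗[K] L.carrier), r ∈ altRel L ∧ t = x ⊗ₜ[K] r} ∪
     {t | ∃ (α β : ZMod 2) (x : L.grading α) (y : L.grading β) (z : L.carrier),
        t = x.1 ⊗ₜ[K] (y.1 ⊗ₜ[K] z) + ssign α β • (y.1 ⊗ₜ[K] (x.1 ⊗ₜ[K] z))})


/-- The submodule `D(M,N)` of `M ⊗_K N` of Proposition 3 (tensoriso). -/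
def DMN {K : Type} [CommRing K] (M N : LieSuperalgebra K)
    (aMN : LieSuperAction M N) (aNM : LieSuperAction N M) :
    Submodule K (M.carrier ⊗[K] N.carrier) :=
  Submodule.span K
    ({t | ∃ (α α' β : ZMod 2) (m : M.grading α) (m' : M.grading α') (n : N.grading β),
        t = (M.bracket m.1 m'.1) ⊗ₜ[K] n.1 - m.1 ⊗ₜ[K] (aMN.act m'.1 n.1)
            + ssign α α' • (m'.1 ⊗ₜ[K] (aMN.act m.1 n.1))} ∪
     {t | ∃ (α β β' : ZMod 2) (m : M.grading α) (n : N.grading β) (n' : N.grading β'),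
        t = m.1 ⊗ₜ[K] (N.bracket n.1 n'.1)
            - ssign β' (α + β) • ((aNM.act n'.1 m.1) ⊗ₜ[K] n.1)
            + ssign α β • ((aNM.act n.1 m.1) ⊗ₜ[K] n'.1)} ∪
     {t | ∃ (α : ZMod 2) (m : M.grading α) (n : N.grading α),
        t = (aNM.act n.1 m.1) ⊗ₜ[K] (aMN.act m.1 n.1)} ∪
     {t | ∃ (α β α' β' : ZMod 2) (m : M.grading α) (n : N.grading β)
            (m' : M.grading α') (n' : N.grading β'),
        t = ssign α β • ((aNM.act n.1 m.1) ⊗ₜ[K] (aMN.act m'.1 n'.1))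
            + (ssign (α + β) (α' + β') * ssign α' β') •
                ((aNM.act n'.1 m'.1) ⊗ₜ[K] (aMN.act m.1 n.1))} ∪
     {t | ∃ (α β α' β' α'' β'' : ZMod 2) (m : M.grading α) (n : N.grading β)
            (m' : M.grading α') (n' : N.grading β')
            (m'' : M.grading α'') (n'' : N.grading β''),
        t = (ssign (α + β) (α'' + β'') * ssign α β * ssign α' β') •
              ((M.bracket (aNM.act n.1 m.1) (aNM.act n'.1 m'.1)) ⊗ₜ[K] (aMN.act m''.1 n''.1))
            + (ssign (α' + β') (α + β) * ssign α' β' * ssign α'' β'') •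
              ((M.bracket (aNM.act n'.1 m'.1) (aNM.act n''.1 m''.1)) ⊗ₜ[K] (aMN.act m.1 n.1))
            + (ssign (α'' + β'') (α' + β') * ssign α'' β'' * ssign α β) •
              ((M.bracket (aNM.act n''.1 m''.1) (aNM.act n.1 m.1)) ⊗ₜ[K] (aMN.act m'.1 n'.1))})

section Signs

lemma ssign_comm (α β : ZMod 2) : ssign α β = ssign β α := by
  simp only [ssign, mul_comm]

lemma ssign_add_left (α β γ : ZMod 2) : ssign (α + β) γ = ssign α γ * ssign β γ := by
  revert α β γ; decide

lemma ssign_add_right (α β γ : ZMod 2) : ssign α (β + γ) = ssign α β * ssign α γ := by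
  revert α β γ; decide

lemma ssign_eq_one_or (α β : ZMod 2) : ssign α β = 1 ∨ ssign α β = -1 := by
  revert α β; decide

lemma ssign_smul_ssign_smul {A : Type*} [AddCommGroup A] (α β : ZMod 2) (x : A) :
    ssign α β • ssign α β • x = x := by
  rcases ssign_eq_one_or α β with h | h <;> simp [h]

lemma ssign_zero_left (α : ZMod 2) : ssign 0 α = 1 := by
  revert α; decide

end Signs

section InternalGrading

variable {V W : Type} [AddCommGroup V] [Module K V] [AddCommGroup W] [Module K W]

/-- A family of submodules spanning the whole module and separated by endomorphisms is an
internal grading. -/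
lemma isInternal_of_projections {g : ZMod 2 → Submodule K V} (P : ZMod 2 → V →ₗ[K] V)
    (hP : ∀ γ δ, ∀ x ∈ g δ, P γ x = if δ = γ then x else 0) (htop : ⨆ i, g i = ⊤) :
    DirectSum.IsInternal g := by
  rw [DirectSum.isInternal_submodule_iff_iSupIndep_and_iSup_eq_top]
  refine ⟨fun i => ?_, htop⟩
  rw [Submodule.disjoint_def]
  intro x hx hx'
  have hle : ⨆ j, ⨆ (_ : j ≠ i), g j ≤ LinearMap.ker (P i) := by
    refine iSup₂_le fun j hj y hy => ?_
    rw [LinearMap.mem_ker, hP i j y hy, if_neg hj]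
  have h0 : P i x = 0 := hle hx'
  rw [hP i i x hx, if_pos rfl] at h0
  exact h0

/-- The projection of an internally graded module onto a homogeneous component. -/
noncomputable def homProj {g : ZMod 2 → Submodule K V} (h : DirectSum.IsInternal g) (α : ZMod 2) :
    V →ₗ[K] g α :=
  DirectSum.component K (ZMod 2) (fun i => g i) α ∘ₗ
    (LinearEquiv.ofBijective (DirectSum.coeLinearMap g)
      (id h : Function.Bijective _)).symm.toLinearMap

lemma homProj_of_mem {g : ZMod 2 → Submodule K V} (h : DirectSum.IsInternal g) {α : ZMod 2}
    {x : V} (hx : x ∈ g α) : homProj h α x = ⟨x, hx⟩ := by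
  have : (LinearEquiv.ofBijective (DirectSum.coeLinearMap g) (id h : Function.Bijective _)).symm x
      = DirectSum.lof K (ZMod 2) (fun i => g i) α ⟨x, hx⟩ := by
    rw [LinearEquiv.symm_apply_eq]
    exact (DirectSum.coeLinearMap_lof g α ⟨x, hx⟩).symm
  simp [homProj, this, DirectSum.component.lof_self]

lemma homProj_of_ne {g : ZMod 2 → Submodule K V} (h : DirectSum.IsInternal g) {α β : ZMod 2}
    (hne : α ≠ β) {x : V} (hx : x ∈ g α) : homProj h β x = 0 := by
  have : (LinearEquiv.ofBijective (DirectSum.coeLinearMap g) (id h : Function.Bijective _)).symm x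
      = DirectSum.lof K (ZMod 2) (fun i => g i) α ⟨x, hx⟩ := by
    rw [LinearEquiv.symm_apply_eq]
    exact (DirectSum.coeLinearMap_lof g α ⟨x, hx⟩).symm
  simp [homProj, this, DirectSum.component.of, hne]

/-- A submodule of a tensor product containing all homogeneous pure tensors is everything. -/
lemma eq_top_of_homogeneous_tmul_mem {gV : ZMod 2 → Submodule K V} {gW : ZMod 2 → Submodule K W}
    (hV : ⨆ i, gV i = ⊤) (hW : ⨆ i, gW i = ⊤) {S : Submodule K (V ⊗[K] W)}
    (h : ∀ α β, ∀ v ∈ gV α, ∀ w ∈ gW β, v ⊗ₜ[K] w ∈ S) : S = ⊤ := by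
  rw [eq_top_iff, ← TensorProduct.span_tmul_eq_top, Submodule.span_le]
  rintro _ ⟨v, w, rfl⟩
  have h1 : ∀ β, ∀ w ∈ gW β, ∀ v : V, v ⊗ₜ[K] w ∈ S := by
    intro β w hw v
    have hle : ⨆ i, gV i ≤ S.comap ((TensorProduct.mk K V W).flip w) :=
      iSup_le fun α v hv => h α β v hv w hw
    exact hle (hV ▸ Submodule.mem_top)
  have hle : ⨆ i, gW i ≤ S.comap (TensorProduct.mk K V W v) :=
    iSup_le fun β w hw => h1 β w hw v
  exact hle (hW ▸ Submodule.mem_top)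

lemma tmul_mem_gradeTensor {gV : ZMod 2 → Submodule K V} {gW : ZMod 2 → Submodule K W}
    {α β : ZMod 2} {v : V} {w : W} (hv : v ∈ gV α) (hw : w ∈ gW β) :
    v ⊗ₜ[K] w ∈ gradeTensor gV gW (α + β) :=
  Submodule.subset_span ⟨α, β, v, w, rfl, hv, hw, rfl⟩

lemma gradeTensor_le {gV : ZMod 2 → Submodule K V} {gW : ZMod 2 → Submodule K W} {γ : ZMod 2}
    {S : Submodule K (V ⊗[K] W)}
    (h : ∀ α β, α + β = γ → ∀ v ∈ gV α, ∀ w ∈ gW β, v ⊗ₜ[K] w ∈ S) :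
    gradeTensor gV gW γ ≤ S := by
  refine Submodule.span_le.2 ?_
  rintro _ ⟨α, β, v, w, hγ, hv, hw, rfl⟩
  exact h α β hγ v hv w hw

lemma iSup_gradeTensor {gV : ZMod 2 → Submodule K V} {gW : ZMod 2 → Submodule K W}
    (hV : ⨆ i, gV i = ⊤) (hW : ⨆ i, gW i = ⊤) : ⨆ i, gradeTensor gV gW i = ⊤ :=
  eq_top_of_homogeneous_tmul_mem hV hW fun α β _ hv _ hw =>
    Submodule.mem_iSup_of_mem (α + β) (tmul_mem_gradeTensor hv hw)

/-- The projection of a tensor product of graded modules onto a homogeneous component. -/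
noncomputable def tensorProj {gV : ZMod 2 → Submodule K V} {gW : ZMod 2 → Submodule K W}
    (hV : DirectSum.IsInternal gV) (hW : DirectSum.IsInternal gW) (γ : ZMod 2) :
    V ⊗[K] W →ₗ[K] V ⊗[K] W :=
  ∑ α, TensorProduct.map ((gV α).subtype ∘ₗ homProj hV α)
    ((gW (γ - α)).subtype ∘ₗ homProj hW (γ - α))

lemma tensorProj_of_mem {gV : ZMod 2 → Submodule K V} {gW : ZMod 2 → Submodule K W}
    (hV : DirectSum.IsInternal gV) (hW : DirectSum.IsInternal gW) (γ δ : ZMod 2) (x : V ⊗[K] W)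
    (hx : x ∈ gradeTensor gV gW δ) :
    tensorProj hV hW γ x = if δ = γ then x else 0 := by
  have hle : gradeTensor gV gW δ ≤ LinearMap.ker (tensorProj hV hW γ
      - (if δ = γ then LinearMap.id else 0)) := by
    refine gradeTensor_le ?_
    rintro α β rfl v hv w hw
    rw [LinearMap.mem_ker, LinearMap.sub_apply, sub_eq_zero, tensorProj, LinearMap.sum_apply,
      Finset.sum_eq_single α]
    · by_cases hb : α + β = γ
      · have hb' : γ - α = β := by rw [← hb]; abel
        subst hb'
        simp [homProj_of_mem hV hv, homProj_of_mem hW hw]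
      · have hb' : β ≠ γ - α := fun h => hb (by rw [h]; abel)
        simp [homProj_of_ne hW hb' hw, hb]
    · intro α' _ hα'
      simp [homProj_of_ne hV hα'.symm hv]
    · simp
  have := hle hx
  rw [LinearMap.mem_ker, LinearMap.sub_apply, sub_eq_zero] at this
  rw [this]
  split_ifs <;> rfl

/-- The quotient of a graded module by a submodule stable under separating projections is
graded. -/
lemma isInternal_gradeQuot {g : ZMod 2 → Submodule K V} (P : ZMod 2 → V →ₗ[K] V)
    (hP : ∀ γ δ, ∀ x ∈ g δ, P γ x = if δ = γ then x else 0) (htop : ⨆ i, g i = ⊤)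
    (S : Submodule K V) (hS : ∀ γ, S ≤ S.comap (P γ)) :
    DirectSum.IsInternal (gradeQuot g S) := by
  refine isInternal_of_projections (fun γ => S.mapQ S (P γ) (hS γ)) ?_ ?_
  · rintro γ δ _ ⟨x, hx, rfl⟩
    rw [Submodule.mkQ_apply, Submodule.mapQ_apply, hP γ δ x hx]
    split_ifs <;> simp
  · simp only [gradeQuot]
    rw [← Submodule.map_iSup, htop, Submodule.map_top, Submodule.range_mkQ]

/-- The linear map on a tensor product of graded modules with prescribed restrictions to
pairs of homogeneous components. -/
noncomputable def homLift {U : Type} [AddCommGroup U] [Module K U] {gV : ZMod 2 → Submodule K V}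
    {gW : ZMod 2 → Submodule K W} (hV : DirectSum.IsInternal gV) (hW : DirectSum.IsInternal gW)
    (B : ∀ α β, gV α →ₗ[K] gW β →ₗ[K] U) : V ⊗[K] W →ₗ[K] U :=
  TensorProduct.lift (∑ α, ∑ β, (B α β).compl₁₂ (homProj hV α) (homProj hW β))

lemma homLift_tmul {U : Type} [AddCommGroup U] [Module K U] {gV : ZMod 2 → Submodule K V}
    {gW : ZMod 2 → Submodule K W} (hV : DirectSum.IsInternal gV) (hW : DirectSum.IsInternal gW)
    (B : ∀ α β, gV α →ₗ[K] gW β →ₗ[K] U) {α β : ZMod 2} {v : V} {w : W} (hv : v ∈ gV α)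
    (hw : w ∈ gW β) : homLift hV hW B (v ⊗ₜ[K] w) = B α β ⟨v, hv⟩ ⟨w, hw⟩ := by
  rw [homLift, TensorProduct.lift.tmul, LinearMap.sum_apply, LinearMap.sum_apply,
    Finset.sum_eq_single α, LinearMap.sum_apply, LinearMap.sum_apply, Finset.sum_eq_single β]
  · simp [homProj_of_mem hV hv, homProj_of_mem hW hw]
  · intro β' _ hβ'
    simp [homProj_of_ne hW hβ'.symm hw]
  · simp
  · intro α' _ hα'
    simp [homProj_of_ne hV hα'.symm hv]
  · simp

end InternalGrading

section TensorQuotient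

variable {M N : LieSuperalgebra K} {aMN : LieSuperAction M N} {aNM : LieSuperAction N M}

lemma LieSuperalgebra.iSup_grading (L : LieSuperalgebra K) : ⨆ i, L.grading i = ⊤ :=
  L.isInternal.submodule_iSup_eq_top

/-- The even linear map `m ⊗ n ↦ (-1)^(|m||n|) ⁿm`. -/
noncomputable def toLeft (aNM : LieSuperAction N M) : M.carrier ⊗[K] N.carrier →ₗ[K] M.carrier :=
  homLift M.isInternal N.isInternal fun α β =>
    ssign α β • (aNM.act.flip.compl₁₂ (M.grading α).subtype (N.grading β).subtype)

/-- The even linear map `m ⊗ n ↦ ᵐn`. -/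
noncomputable def toRight (aMN : LieSuperAction M N) : M.carrier ⊗[K] N.carrier →ₗ[K] N.carrier :=
  TensorProduct.lift aMN.act

lemma toLeft_tmul (aNM : LieSuperAction N M) {α β : ZMod 2} {m : M.carrier} {n : N.carrier}
    (hm : m ∈ M.grading α) (hn : n ∈ N.grading β) :
    toLeft aNM (m ⊗ₜ[K] n) = ssign α β • aNM.act n m := by
  rw [toLeft, homLift_tmul _ _ _ hm hn]
  simp

lemma act_eq_toLeft (aNM : LieSuperAction N M) {α β : ZMod 2} {m : M.carrier} {n : N.carrier}
    (hm : m ∈ M.grading α) (hn : n ∈ N.grading β) :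
    aNM.act n m = ssign α β • toLeft aNM (m ⊗ₜ[K] n) := by
  rw [toLeft_tmul aNM hm hn, ssign_smul_ssign_smul]

@[simp]
lemma toRight_tmul (aMN : LieSuperAction M N) (m : M.carrier) (n : N.carrier) :
    toRight aMN (m ⊗ₜ[K] n) = aMN.act m n := rfl

lemma toLeft_mem (aNM : LieSuperAction N M) {γ : ZMod 2} {x : M.carrier ⊗[K] N.carrier}
    (hx : x ∈ gradeTensor M.grading N.grading γ) : toLeft aNM x ∈ M.grading γ := by
  have hle : gradeTensor M.grading N.grading γ ≤ (M.grading γ).comap (toLeft aNM) := by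
    refine gradeTensor_le ?_
    rintro α β rfl m hm n hn
    rw [Submodule.mem_comap, toLeft_tmul aNM hm hn, add_comm α β]
    exact zsmul_mem (aNM.act_grading β α n m hn hm) _
  exact hle hx

lemma toRight_mem (aMN : LieSuperAction M N) {γ : ZMod 2} {x : M.carrier ⊗[K] N.carrier}
    (hx : x ∈ gradeTensor M.grading N.grading γ) : toRight aMN x ∈ N.grading γ := by
  have hle : gradeTensor M.grading N.grading γ ≤ (N.grading γ).comap (toRight aMN) := by
    refine gradeTensor_le ?_
    rintro α β rfl m hm n hn
    exact aMN.act_grading α β m n hm hn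
  exact hle hx

/-- Linear maps agreeing on homogeneous pure tensors are equal. -/
lemma ext_homogeneous {U : Type} [AddCommGroup U] [Module K U]
    {f g : M.carrier ⊗[K] N.carrier →ₗ[K] U}
    (h : ∀ α β, ∀ m ∈ M.grading α, ∀ n ∈ N.grading β, f (m ⊗ₜ[K] n) = g (m ⊗ₜ[K] n)) :
    f = g := by
  have := eq_top_of_homogeneous_tmul_mem M.iSup_grading N.iSup_grading
    (S := LinearMap.eqLocus f g) h
  exact LinearMap.eqLocus_eq_top.1 this

/-- A graded-linear statement holds everywhere once it holds on homogeneous tensors. -/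
lemma eq_of_gradeTensor {U : Type} [AddCommGroup U] [Module K U]
    {f g : M.carrier ⊗[K] N.carrier →ₗ[K] U}
    (h : ∀ γ, ∀ x ∈ gradeTensor M.grading N.grading γ, f x = g x) : f = g :=
  ext_homogeneous fun α β _ hm _ hn => h (α + β) _ (tmul_mem_gradeTensor hm hn)

lemma LieSuperalgebra.ext_linear {L : LieSuperalgebra K} {U : Type} [AddCommGroup U] [Module K U]
    {f g : L.carrier →ₗ[K] U} (h : ∀ α, ∀ x ∈ L.grading α, f x = g x) : f = g := by
  have : ⨆ i, L.grading i ≤ LinearMap.eqLocus f g := iSup_le h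
  rw [L.iSup_grading, top_le_iff] at this
  exact LinearMap.eqLocus_eq_top.1 this

lemma act_toLeft (hcomp : AreCompatible aMN aNM) (x : M.carrier ⊗[K] N.carrier) (n : N.carrier) :
    aMN.act (toLeft aNM x) n = -N.bracket (toRight aMN x) n := by
  have h : aMN.act ∘ₗ toLeft aNM = -(N.bracket ∘ₗ toRight aMN) := by
    refine ext_homogeneous fun α β m hm n hn => LinearMap.ext fun n' => ?_
    have := hcomp.compat_left α β m n hm hn n'
    simp only [LinearMap.comp_apply, toLeft_tmul aNM hm hn, map_zsmul, LinearMap.smul_apply, this,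
      smul_neg, ssign_smul_ssign_smul, LinearMap.neg_apply, toRight_tmul]
  exact LinearMap.congr_fun (LinearMap.congr_fun h x) n

lemma act_toRight (hcomp : AreCompatible aMN aNM) (x : M.carrier ⊗[K] N.carrier) (m : M.carrier) :
    aNM.act (toRight aMN x) m = -M.bracket (toLeft aNM x) m := by
  have h : aNM.act ∘ₗ toRight aMN = -(M.bracket ∘ₗ toLeft aNM) := by
    refine ext_homogeneous fun α β m hm n hn => LinearMap.ext fun m' => ?_
    have := hcomp.compat_right α β m n hm hn m'
    simp only [LinearMap.comp_apply, toLeft_tmul aNM hm hn, map_zsmul, LinearMap.smul_apply, this,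
      LinearMap.neg_apply, toRight_tmul]
  exact LinearMap.congr_fun (LinearMap.congr_fun h x) m

lemma toLeft_tmul_toRight (hcomp : AreCompatible aMN aNM) (m : M.carrier)
    (x : M.carrier ⊗[K] N.carrier) :
    toLeft aNM (m ⊗ₜ[K] toRight aMN x) = M.bracket m (toLeft aNM x) := by
  have h : ((TensorProduct.mk K M.carrier N.carrier).compr₂ (toLeft aNM)).compl₂ (toRight aMN)
      = M.bracket.compl₂ (toLeft aNM) := by
    refine LieSuperalgebra.ext_linear fun α m hm => eq_of_gradeTensor fun γ x hx => ?_
    simp only [LinearMap.compl₂_apply, LinearMap.compr₂_apply, TensorProduct.mk_apply]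
    rw [toLeft_tmul aNM hm (toRight_mem aMN hx), act_toRight hcomp,
      M.super_skew α γ m _ hm (toLeft_mem aNM hx), smul_neg]
  exact LinearMap.congr_fun (LinearMap.congr_fun h m) x

lemma toRight_toLeft_tmul (hcomp : AreCompatible aMN aNM) (x : M.carrier ⊗[K] N.carrier)
    (n : N.carrier) :
    toRight aMN (toLeft aNM x ⊗ₜ[K] n) = -N.bracket (toRight aMN x) n :=
  act_toLeft hcomp x n

section Relations

local notation "D" => DMN M N aMN aNM
local notation "gr" => gradeTensor M.grading N.grading
local notation "φ" => toLeft aNM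
local notation "ψ" => toRight aMN

lemma bracket_tmul_mem_DMN (α α' β : ZMod 2) (m : M.grading α) (m' : M.grading α')
    (n : N.grading β) :
    (M.bracket m.1 m'.1) ⊗ₜ[K] n.1 - m.1 ⊗ₜ[K] (aMN.act m'.1 n.1)
            + ssign α α' • (m'.1 ⊗ₜ[K] (aMN.act m.1 n.1)) ∈ D :=
  Submodule.subset_span (Or.inl (Or.inl (Or.inl (Or.inl ⟨α, α', β, m, m', n, rfl⟩))))

lemma tmul_bracket_mem_DMN (α β β' : ZMod 2) (m : M.grading α) (n : N.grading β)
    (n' : N.grading β') :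
    m.1 ⊗ₜ[K] (N.bracket n.1 n'.1)
            - ssign β' (α + β) • ((aNM.act n'.1 m.1) ⊗ₜ[K] n.1)
            + ssign α β • ((aNM.act n.1 m.1) ⊗ₜ[K] n'.1) ∈ D :=
  Submodule.subset_span (Or.inl (Or.inl (Or.inl (Or.inr ⟨α, β, β', m, n, n', rfl⟩))))

lemma zsmul_tmul (c : ℤ) (m : M.carrier) (n : N.carrier) :
    (c • m) ⊗ₜ[K] n = c • (m ⊗ₜ[K] n) :=
  map_zsmul ((TensorProduct.mk K M.carrier N.carrier).flip n) c m

lemma toLeft_tmul_toRight_mem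
    {a b : ZMod 2} {x y : M.carrier ⊗[K] N.carrier} (hx : x ∈ gr a) (hy : y ∈ gr b) :
    φ x ⊗ₜ[K] ψ y ∈ gr (a + b) :=
  tmul_mem_gradeTensor (toLeft_mem aNM hx) (toRight_mem aMN hy)

/-- The bilinear map `(x, y) ↦ φ x ⊗ ψ y`, minus which induces the bracket on the quotient. -/
noncomputable def preBracket (aMN : LieSuperAction M N) (aNM : LieSuperAction N M) :
    M.carrier ⊗[K] N.carrier →ₗ[K] M.carrier ⊗[K] N.carrier →ₗ[K] M.carrier ⊗[K] N.carrier :=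
  (TensorProduct.mk K M.carrier N.carrier).compl₁₂ (toLeft aNM) (toRight aMN)

@[simp]
lemma preBracket_apply (x y : M.carrier ⊗[K] N.carrier) :
    preBracket aMN aNM x y = φ x ⊗ₜ[K] ψ y := rfl

lemma tmul_self_mem_DMN (α : ZMod 2) {m : M.carrier} {n : N.carrier} (hm : m ∈ M.grading α)
    (hn : n ∈ N.grading α) : φ (m ⊗ₜ[K] n) ⊗ₜ[K] ψ (m ⊗ₜ[K] n) ∈ D := by
  rw [toLeft_tmul aNM hm hn, zsmul_tmul, toRight_tmul]
  have : _ ∈ D := Submodule.subset_span (Or.inl (Or.inl (Or.inr ⟨α, ⟨m, hm⟩, ⟨n, hn⟩, rfl⟩)))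
  exact zsmul_mem this _

lemma skew_rel_eq {α β α' β' : ZMod 2} {m m' : M.carrier} {n n' : N.carrier}
    (hm : m ∈ M.grading α) (hn : n ∈ N.grading β) (hm' : m' ∈ M.grading α')
    (hn' : n' ∈ N.grading β') :
    ssign α β • ((aNM.act n m) ⊗ₜ[K] (aMN.act m' n'))
            + (ssign (α + β) (α' + β') * ssign α' β') • ((aNM.act n' m') ⊗ₜ[K] (aMN.act m n))
      = φ (m ⊗ₜ[K] n) ⊗ₜ[K] ψ (m' ⊗ₜ[K] n')
        + ssign (α + β) (α' + β') • (φ (m' ⊗ₜ[K] n') ⊗ₜ[K] ψ (m ⊗ₜ[K] n)) := by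
  rw [toLeft_tmul aNM hm hn, toLeft_tmul aNM hm' hn', zsmul_tmul, zsmul_tmul, smul_smul,
    toRight_tmul, toRight_tmul]

lemma cyclic_rel_eq {α β α' β' α'' β'' : ZMod 2} {m m' m'' : M.carrier} {n n' n'' : N.carrier}
    (hm : m ∈ M.grading α) (hn : n ∈ N.grading β) (hm' : m' ∈ M.grading α')
    (hn' : n' ∈ N.grading β') (hm'' : m'' ∈ M.grading α'') (hn'' : n'' ∈ N.grading β'') :
    (ssign (α + β) (α'' + β'') * ssign α β * ssign α' β') •
              ((M.bracket (aNM.act n m) (aNM.act n' m')) ⊗ₜ[K] (aMN.act m'' n''))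
            + (ssign (α' + β') (α + β) * ssign α' β' * ssign α'' β'') •
              ((M.bracket (aNM.act n' m') (aNM.act n'' m'')) ⊗ₜ[K] (aMN.act m n))
            + (ssign (α'' + β'') (α' + β') * ssign α'' β'' * ssign α β) •
              ((M.bracket (aNM.act n'' m'') (aNM.act n m)) ⊗ₜ[K] (aMN.act m' n'))
      = ssign (α + β) (α'' + β'') •
          (M.bracket (φ (m ⊗ₜ[K] n)) (φ (m' ⊗ₜ[K] n')) ⊗ₜ[K] ψ (m'' ⊗ₜ[K] n''))
        + ssign (α' + β') (α + β) •
          (M.bracket (φ (m' ⊗ₜ[K] n')) (φ (m'' ⊗ₜ[K] n'')) ⊗ₜ[K] ψ (m ⊗ₜ[K] n))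
        + ssign (α'' + β'') (α' + β') •
          (M.bracket (φ (m'' ⊗ₜ[K] n'')) (φ (m ⊗ₜ[K] n)) ⊗ₜ[K] ψ (m' ⊗ₜ[K] n')) := by
  simp only [toLeft_tmul aNM hm hn, toLeft_tmul aNM hm' hn', toLeft_tmul aNM hm'' hn'',
    map_zsmul, LinearMap.smul_apply, zsmul_tmul, smul_smul, toRight_tmul]
  module

lemma skew_mem_DMN {a b : ZMod 2} {x y : M.carrier ⊗[K] N.carrier} (hx : x ∈ gr a)
    (hy : y ∈ gr b) : φ x ⊗ₜ[K] ψ y + ssign a b • (φ y ⊗ₜ[K] ψ x) ∈ D := by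
  have h1 : gr a ≤ (D).comap
      ((preBracket aMN aNM).flip y + ssign a b • preBracket aMN aNM y) := by
    refine gradeTensor_le ?_
    rintro α β rfl m hm n hn
    have h2 : gr b ≤ (D).comap (preBracket aMN aNM (m ⊗ₜ[K] n)
        + ssign (α + β) b • (preBracket aMN aNM).flip (m ⊗ₜ[K] n)) := by
      refine gradeTensor_le ?_
      rintro α' β' rfl m' hm' n' hn'
      have : _ ∈ D := Submodule.subset_span
        (Or.inl (Or.inr ⟨α, β, α', β', ⟨m, hm⟩, ⟨n, hn⟩, ⟨m', hm'⟩, ⟨n', hn'⟩, rfl⟩))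
      rwa [skew_rel_eq hm hn hm' hn'] at this
    exact h2 hy
  exact h1 hx

lemma cyclic_mem_DMN {a b c : ZMod 2} {x y z : M.carrier ⊗[K] N.carrier} (hx : x ∈ gr a)
    (hy : y ∈ gr b) (hz : z ∈ gr c) :
    ssign a c • (M.bracket (φ x) (φ y) ⊗ₜ[K] ψ z) + ssign b a • (M.bracket (φ y) (φ z) ⊗ₜ[K] ψ x)
      + ssign c b • (M.bracket (φ z) (φ x) ⊗ₜ[K] ψ y) ∈ D := by
  let A : M.carrier →ₗ[K] M.carrier ⊗[K] N.carrier →ₗ[K] M.carrier ⊗[K] N.carrier :=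
    (TensorProduct.mk K M.carrier N.carrier).compl₂ ψ
  let C : M.carrier ⊗[K] N.carrier →ₗ[K] M.carrier ⊗[K] N.carrier →ₗ[K] M.carrier :=
    M.bracket.compl₁₂ φ φ
  have h1 : gr a ≤ (D).comap (ssign a c • (A.flip z ∘ₗ C.flip y) + ssign b a • A (C y z)
      + ssign c b • (A.flip y ∘ₗ C z)) := by
    refine gradeTensor_le ?_
    rintro α β rfl m hm n hn
    have h2 : gr b ≤ (D).comap (ssign (α + β) c • (A.flip z ∘ₗ C (m ⊗ₜ[K] n))
        + ssign b (α + β) • (A.flip (m ⊗ₜ[K] n) ∘ₗ C.flip z)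
        + ssign c b • A (C z (m ⊗ₜ[K] n))) := by
      refine gradeTensor_le ?_
      rintro α' β' rfl m' hm' n' hn'
      have h3 : gr c ≤ (D).comap (ssign (α + β) c • A (C (m ⊗ₜ[K] n) (m' ⊗ₜ[K] n'))
          + ssign (α' + β') (α + β) • (A.flip (m ⊗ₜ[K] n) ∘ₗ C (m' ⊗ₜ[K] n'))
          + ssign c (α' + β') • (A.flip (m' ⊗ₜ[K] n') ∘ₗ C.flip (m ⊗ₜ[K] n))) := by
        refine gradeTensor_le ?_
        rintro α'' β'' rfl m'' hm'' n'' hn''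
        have : _ ∈ D := Submodule.subset_span
          (Or.inr ⟨α, β, α', β', α'', β'', ⟨m, hm⟩, ⟨n, hn⟩, ⟨m', hm'⟩, ⟨n', hn'⟩,
            ⟨m'', hm''⟩, ⟨n'', hn''⟩, rfl⟩)
        rwa [cyclic_rel_eq hm hn hm' hn' hm'' hn''] at this
      exact h3 hz
    exact h2 hy
  exact h1 hx

/-- To check that a submodule contains `D(M,N)` it suffices to check the relations in terms of
homogeneous elements of `M ⊗ N`. -/
lemma DMN_le {S : Submodule K (M.carrier ⊗[K] N.carrier)}
    (h_left : ∀ (α α' β : ZMod 2) (m : M.grading α) (m' : M.grading α') (n : N.grading β),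
      (M.bracket m.1 m'.1) ⊗ₜ[K] n.1 - m.1 ⊗ₜ[K] (aMN.act m'.1 n.1)
            + ssign α α' • (m'.1 ⊗ₜ[K] (aMN.act m.1 n.1)) ∈ S)
    (h_right : ∀ (α β β' : ZMod 2) (m : M.grading α) (n : N.grading β) (n' : N.grading β'),
      m.1 ⊗ₜ[K] (N.bracket n.1 n'.1)
            - ssign β' (α + β) • ((aNM.act n'.1 m.1) ⊗ₜ[K] n.1)
            + ssign α β • ((aNM.act n.1 m.1) ⊗ₜ[K] n'.1) ∈ S)
    (h_self : ∀ x ∈ gr 0, φ x ⊗ₜ[K] ψ x ∈ D → φ x ⊗ₜ[K] ψ x ∈ S)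
    (h_skew : ∀ (a b : ZMod 2), ∀ x ∈ gr a, ∀ y ∈ gr b,
      φ x ⊗ₜ[K] ψ y + ssign a b • (φ y ⊗ₜ[K] ψ x) ∈ S)
    (h_cyclic : ∀ (a b c : ZMod 2), ∀ x ∈ gr a, ∀ y ∈ gr b, ∀ z ∈ gr c,
      ssign a c • (M.bracket (φ x) (φ y) ⊗ₜ[K] ψ z)
        + ssign b a • (M.bracket (φ y) (φ z) ⊗ₜ[K] ψ x)
        + ssign c b • (M.bracket (φ z) (φ x) ⊗ₜ[K] ψ y) ∈ S) : D ≤ S := by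
  refine Submodule.span_le.2 ?_
  rintro t ((((h | h) | h) | h) | h)
  · obtain ⟨α, α', β, m, m', n, rfl⟩ := h
    exact h_left α α' β m m' n
  · obtain ⟨α, β, β', m, n, n', rfl⟩ := h
    exact h_right α β β' m n n'
  · obtain ⟨α, ⟨m, hm⟩, ⟨n, hn⟩, rfl⟩ := h
    have hx : m ⊗ₜ[K] n ∈ gr 0 := by
      simpa [CharTwo.add_self_eq_zero] using tmul_mem_gradeTensor hm hn
    have := h_self _ hx (tmul_self_mem_DMN α hm hn)
    rw [SetLike.mem_coe, act_eq_toLeft aNM hm hn, zsmul_tmul]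
    exact zsmul_mem this _
  · obtain ⟨α, β, α', β', ⟨m, hm⟩, ⟨n, hn⟩, ⟨m', hm'⟩, ⟨n', hn'⟩, rfl⟩ := h
    rw [SetLike.mem_coe, skew_rel_eq hm hn hm' hn']
    exact h_skew _ _ _ (tmul_mem_gradeTensor hm hn) _ (tmul_mem_gradeTensor hm' hn')
  · obtain ⟨α, β, α', β', α'', β'', ⟨m, hm⟩, ⟨n, hn⟩, ⟨m', hm'⟩, ⟨n', hn'⟩, ⟨m'', hm''⟩,
      ⟨n'', hn''⟩, rfl⟩ := h
    rw [SetLike.mem_coe, cyclic_rel_eq hm hn hm' hn' hm'' hn'']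
    exact h_cyclic _ _ _ _ (tmul_mem_gradeTensor hm hn) _ (tmul_mem_gradeTensor hm' hn') _
      (tmul_mem_gradeTensor hm'' hn'')

lemma self_mem_DMN {x : M.carrier ⊗[K] N.carrier} (hx : x ∈ gr 0) : φ x ⊗ₜ[K] ψ x ∈ D := by
  have key : x ∈ gr 0 ∧ φ x ⊗ₜ[K] ψ x ∈ D := by
    refine Submodule.span_induction (p := fun x _ => x ∈ gr 0 ∧ φ x ⊗ₜ[K] ψ x ∈ D)
      ?_ ?_ ?_ ?_ hx
    · rintro _ ⟨α, β, m, n, h0, hm, hn, rfl⟩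
      refine ⟨h0 ▸ tmul_mem_gradeTensor hm hn, ?_⟩
      have hαβ : α = β := CharTwo.add_eq_zero.1 h0
      subst hαβ
      exact tmul_self_mem_DMN α hm hn
    · simp
    · rintro x y - - ⟨hx, hx'⟩ ⟨hy, hy'⟩
      refine ⟨add_mem hx hy, ?_⟩
      have := skew_mem_DMN (aMN := aMN) (aNM := aNM) hx hy
      rw [ssign_zero_left, one_smul] at this
      have h2 := add_mem (add_mem hx' hy') this
      convert h2 using 1
      simp only [map_add, TensorProduct.add_tmul, TensorProduct.tmul_add]
      abel
    · rintro c x - ⟨hx, hx'⟩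
      refine ⟨Submodule.smul_mem _ _ hx, ?_⟩
      rw [map_smul, map_smul, TensorProduct.smul_tmul_smul]
      exact Submodule.smul_mem _ _ hx'
  exact key.2

/-- Cyclic form of the graded Jacobi identity. -/
lemma LieSuperalgebra.cyclic_jacobi (L : LieSuperalgebra K) {a b c : ZMod 2} {x y z : L.carrier}
    (hx : x ∈ L.grading a) (hy : y ∈ L.grading b) (hz : z ∈ L.grading c) :
    ssign a c • L.bracket (L.bracket x y) z + ssign b a • L.bracket (L.bracket y z) x
      + ssign c b • L.bracket (L.bracket z x) y = 0 := by
  have h1 := L.super_jacobi a b x y hx hy z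
  have h2 := L.super_skew (b + c) a (L.bracket y z) x (L.bracket_grading b c y z hy hz) hx
  have h3 := L.super_skew (c + a) b (L.bracket z x) y (L.bracket_grading c a z x hz hx) hy
  have h4 := L.super_skew a c x z hx hz
  rw [h2, h3, h1, h4]
  simp only [ssign_add_left, ssign_comm b a, ssign_comm c a, ssign_comm c b, map_neg, map_zsmul]
  rcases ssign_eq_one_or a b with h | h <;> rcases ssign_eq_one_or a c with h' | h' <;>
    rcases ssign_eq_one_or b c with h'' | h'' <;> simp only [h, h', h''] <;> simp

lemma DMN_le_ker_toLeft (hcomp : AreCompatible aMN aNM) : D ≤ LinearMap.ker φ := by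
  refine DMN_le ?_ ?_ ?_ ?_ ?_
  · intro α α' β m m' n
    have h1 : aNM.act n.1 (M.bracket m.1 m'.1) = _ :=
      aNM.act_super_der β α n.1 m.1 n.2 m.2 m'.1
    rw [LinearMap.mem_ker, map_add, map_sub, map_zsmul,
      toLeft_tmul aNM (M.bracket_grading _ _ _ _ m.2 m'.2) n.2, ← toRight_tmul aMN, ← toRight_tmul aMN,
      toLeft_tmul_toRight hcomp, toLeft_tmul_toRight hcomp, h1, toLeft_tmul aNM m.2 n.2,
      toLeft_tmul aNM m'.2 n.2, M.super_skew α' (α + β) m'.1 _ m'.2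
        (by rw [add_comm]; exact zsmul_mem (aNM.act_grading _ _ _ _ n.2 m.2) _)]
    simp only [ssign_add_left, ssign_add_right, ssign_comm α' α, ssign_comm β α, map_zsmul,
      LinearMap.smul_apply]
    rcases ssign_eq_one_or α β with h | h <;> rcases ssign_eq_one_or α α' with h' | h' <;>
      rcases ssign_eq_one_or α' β with h'' | h'' <;> simp only [h, h', h''] <;> simp
  · intro α β β' m n n'
    have h1 : aNM.act (N.bracket n.1 n'.1) m.1 = _ := aNM.act_bracket β β' n.1 n'.1 n.2 n'.2 m.1
    rw [LinearMap.mem_ker, map_add, map_sub, map_zsmul, map_zsmul,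
      toLeft_tmul aNM m.2 (N.bracket_grading _ _ _ _ n.2 n'.2),
      toLeft_tmul aNM (aNM.act_grading _ _ _ _ n'.2 m.2) n.2,
      toLeft_tmul aNM (aNM.act_grading _ _ _ _ n.2 m.2) n'.2, h1]
    simp only [ssign_add_left, ssign_add_right, ssign_comm β' α, ssign_comm β' β]
    rcases ssign_eq_one_or α β with h | h <;> rcases ssign_eq_one_or α β' with h' | h' <;>
      rcases ssign_eq_one_or β β' with h'' | h'' <;> simp only [h, h', h''] <;> simp
  · intro x hx _
    rw [LinearMap.mem_ker, toLeft_tmul_toRight hcomp, M.bracket_self_even _ (toLeft_mem aNM hx)]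
  · intro a b x hx y hy
    rw [LinearMap.mem_ker, map_add, map_zsmul, toLeft_tmul_toRight hcomp,
      toLeft_tmul_toRight hcomp, M.super_skew a b _ _ (toLeft_mem aNM hx) (toLeft_mem aNM hy),
      neg_add_cancel]
  · intro a b c x hx y hy z hz
    simp only [LinearMap.mem_ker, map_add, map_zsmul, toLeft_tmul_toRight hcomp]
    exact M.cyclic_jacobi (toLeft_mem aNM hx) (toLeft_mem aNM hy) (toLeft_mem aNM hz)

lemma toRight_bracket_toLeft_tmul (hcomp : AreCompatible aMN aNM)
    (x y z : M.carrier ⊗[K] N.carrier) :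
    ψ (M.bracket (φ x) (φ y) ⊗ₜ[K] ψ z) = N.bracket (N.bracket (ψ x) (ψ y)) (ψ z) := by
  rw [← toLeft_tmul_toRight hcomp, toRight_toLeft_tmul hcomp, toRight_toLeft_tmul hcomp]
  simp

lemma DMN_le_ker_toRight (hcomp : AreCompatible aMN aNM) : D ≤ LinearMap.ker ψ := by
  refine DMN_le ?_ ?_ ?_ ?_ ?_
  · intro α α' β m m' n
    have h1 : aMN.act (M.bracket m.1 m'.1) n.1 = _ :=
      aMN.act_bracket α α' m.1 m'.1 m.2 m'.2 n.1
    rw [LinearMap.mem_ker, map_add, map_sub, map_zsmul, toRight_tmul, toRight_tmul, toRight_tmul,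
      h1]
    abel
  · intro α β β' m n n'
    have h1 : aMN.act m.1 (N.bracket n.1 n'.1) = _ :=
      aMN.act_super_der α β m.1 n.1 m.2 n.2 n'.1
    rw [LinearMap.mem_ker, map_add, map_sub, map_zsmul, map_zsmul, act_eq_toLeft aNM m.2 n.2,
      act_eq_toLeft aNM m.2 n'.2, zsmul_tmul, zsmul_tmul, map_zsmul, map_zsmul,
      toRight_toLeft_tmul hcomp, toRight_toLeft_tmul hcomp, toRight_tmul, toRight_tmul,
      toRight_tmul, h1, N.super_skew β (α + β') n.1 _ n.2 (aMN.act_grading _ _ _ _ m.2 n'.2)]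
    simp only [ssign_add_right, ssign_comm β' α, ssign_comm β' β, ssign_comm β α]
    rcases ssign_eq_one_or α β with h | h <;> rcases ssign_eq_one_or α β' with h' | h' <;>
      rcases ssign_eq_one_or β β' with h'' | h'' <;> simp only [h, h', h''] <;> simp
  · intro x hx _
    rw [LinearMap.mem_ker, toRight_toLeft_tmul hcomp,
      N.bracket_self_even _ (toRight_mem aMN hx), neg_zero]
  · intro a b x hx y hy
    rw [LinearMap.mem_ker, map_add, map_zsmul, toRight_toLeft_tmul hcomp,
      toRight_toLeft_tmul hcomp, N.super_skew a b _ _ (toRight_mem aMN hx) (toRight_mem aMN hy)]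
    simp
  · intro a b c x hx y hy z hz
    simp only [LinearMap.mem_ker, map_add, map_zsmul, toRight_bracket_toLeft_tmul hcomp]
    exact N.cyclic_jacobi (toRight_mem aMN hx) (toRight_mem aMN hy) (toRight_mem aMN hz)

lemma DMN_le_comap_tensorProj (γ : ZMod 2) :
    D ≤ (D).comap (tensorProj M.isInternal N.isInternal γ) := by
  have key : ∀ δ, ∀ t ∈ gr δ, t ∈ D → t ∈ (D).comap (tensorProj M.isInternal N.isInternal γ) := by
    intro δ t ht htD
    rw [Submodule.mem_comap, tensorProj_of_mem _ _ γ δ t ht]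
    split_ifs
    exacts [htD, zero_mem _]
  refine DMN_le ?_ ?_ ?_ ?_ ?_
  · intro α α' β m m' n
    refine key (α + α' + β) _ (add_mem (sub_mem ?_ ?_) (zsmul_mem ?_ _))
      (bracket_tmul_mem_DMN α α' β m m' n)
    · exact tmul_mem_gradeTensor (M.bracket_grading _ _ _ _ m.2 m'.2) n.2
    · rw [add_assoc]
      exact tmul_mem_gradeTensor m.2 (aMN.act_grading _ _ _ _ m'.2 n.2)
    · rw [add_comm α, add_assoc]
      exact tmul_mem_gradeTensor m'.2 (aMN.act_grading _ _ _ _ m.2 n.2)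
  · intro α β β' m n n'
    refine key (α + (β + β')) _ (add_mem (sub_mem ?_ (zsmul_mem ?_ _)) (zsmul_mem ?_ _))
      (tmul_bracket_mem_DMN α β β' m n n')
    · exact tmul_mem_gradeTensor m.2 (N.bracket_grading _ _ _ _ n.2 n'.2)
    · rw [show α + (β + β') = β' + α + β by ring]
      exact tmul_mem_gradeTensor (aNM.act_grading _ _ _ _ n'.2 m.2) n.2
    · rw [show α + (β + β') = β + α + β' by ring]
      exact tmul_mem_gradeTensor (aNM.act_grading _ _ _ _ n.2 m.2) n'.2
  · intro x hx h
    exact key (0 + 0) _ (toLeft_tmul_toRight_mem hx hx) h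
  · intro a b x hx y hy
    refine key (a + b) _ (add_mem (toLeft_tmul_toRight_mem hx hy) (zsmul_mem ?_ _))
      (skew_mem_DMN hx hy)
    rw [add_comm]
    exact toLeft_tmul_toRight_mem hy hx
  · intro a b c x hx y hy z hz
    have aux : ∀ {a b c : ZMod 2} {x y z : M.carrier ⊗[K] N.carrier}, x ∈ gr a → y ∈ gr b →
        z ∈ gr c → M.bracket (φ x) (φ y) ⊗ₜ[K] ψ z ∈ gr (a + b + c) := fun hx hy hz =>
      tmul_mem_gradeTensor (M.bracket_grading _ _ _ _ (toLeft_mem aNM hx) (toLeft_mem aNM hy))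
        (toRight_mem aMN hz)
    refine key (a + b + c) _ (add_mem (add_mem (zsmul_mem (aux hx hy hz) _) (zsmul_mem ?_ _))
      (zsmul_mem ?_ _)) (cyclic_mem_DMN hx hy hz)
    · rw [show a + b + c = b + c + a by ring]
      exact aux hy hz hx
    · rw [show a + b + c = c + a + b by ring]
      exact aux hz hx hy

/-- The bracket on `(M ⊗ N) / D(M,N)`. -/
noncomputable def quotBracket (hcomp : AreCompatible aMN aNM) :
    (M.carrier ⊗[K] N.carrier ⧸ D) →ₗ[K] (M.carrier ⊗[K] N.carrier ⧸ D) →ₗ[K]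
      (M.carrier ⊗[K] N.carrier ⧸ D) :=
  -((TensorProduct.mk K M.carrier N.carrier).compr₂ (D).mkQ).compl₁₂
    ((D).liftQ φ (DMN_le_ker_toLeft hcomp)) ((D).liftQ ψ (DMN_le_ker_toRight hcomp))

lemma quotBracket_mkQ (hcomp : AreCompatible aMN aNM) (x y : M.carrier ⊗[K] N.carrier) :
    quotBracket hcomp ((D).mkQ x) ((D).mkQ y) = -(D).mkQ (φ x ⊗ₜ[K] ψ y) := rfl

lemma quotBracket_quotBracket (hcomp : AreCompatible aMN aNM)
    (x y z : M.carrier ⊗[K] N.carrier) :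
    quotBracket hcomp (quotBracket hcomp ((D).mkQ x) ((D).mkQ y)) ((D).mkQ z)
      = (D).mkQ (M.bracket (φ x) (φ y) ⊗ₜ[K] ψ z) := by
  rw [quotBracket_mkQ, map_neg, LinearMap.neg_apply, quotBracket_mkQ, neg_neg,
    toLeft_tmul_toRight hcomp]

lemma quotBracket_mem (hcomp : AreCompatible aMN aNM) (a b : ZMod 2)
    (x y : M.carrier ⊗[K] N.carrier ⧸ D) (hx : x ∈ gradeQuot gr D a)
    (hy : y ∈ gradeQuot gr D b) : quotBracket hcomp x y ∈ gradeQuot gr D (a + b) := by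
  obtain ⟨x, hx, rfl⟩ := hx
  obtain ⟨y, hy, rfl⟩ := hy
  rw [quotBracket_mkQ]
  exact neg_mem (Submodule.mem_map_of_mem (toLeft_tmul_toRight_mem hx hy))

lemma quotBracket_skew (hcomp : AreCompatible aMN aNM) (a b : ZMod 2)
    (x y : M.carrier ⊗[K] N.carrier ⧸ D) (hx : x ∈ gradeQuot gr D a)
    (hy : y ∈ gradeQuot gr D b) :
    quotBracket hcomp x y = -(ssign a b • quotBracket hcomp y x) := by
  obtain ⟨x, hx, rfl⟩ := hx
  obtain ⟨y, hy, rfl⟩ := hy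
  have h : (D).mkQ _ = 0 :=
    (Submodule.Quotient.mk_eq_zero _).2 (skew_mem_DMN (aMN := aMN) (aNM := aNM) hx hy)
  rw [map_add, map_zsmul] at h
  rw [quotBracket_mkQ, quotBracket_mkQ, smul_neg, neg_neg]
  exact neg_eq_of_add_eq_zero_right h

lemma quotBracket_jacobi (hcomp : AreCompatible aMN aNM) (a b : ZMod 2)
    (x y : M.carrier ⊗[K] N.carrier ⧸ D) (hx : x ∈ gradeQuot gr D a)
    (hy : y ∈ gradeQuot gr D b) (z : M.carrier ⊗[K] N.carrier ⧸ D) :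
    quotBracket hcomp x (quotBracket hcomp y z)
      = quotBracket hcomp (quotBracket hcomp x y) z
        + ssign a b • quotBracket hcomp y (quotBracket hcomp x z) := by
  have key : (quotBracket hcomp x ∘ₗ quotBracket hcomp y) ∘ₗ (D).mkQ
      = (quotBracket hcomp (quotBracket hcomp x y)
        + ssign a b • (quotBracket hcomp y ∘ₗ quotBracket hcomp x)) ∘ₗ (D).mkQ := by
    refine eq_of_gradeTensor fun c z hz => ?_
    have hz' : (D).mkQ z ∈ gradeQuot gr D c := Submodule.mem_map_of_mem hz
    simp only [LinearMap.comp_apply, LinearMap.add_apply, LinearMap.smul_apply]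
    rw [quotBracket_skew hcomp a (b + c) x _ hx (quotBracket_mem hcomp b c y _ hy hz'),
      quotBracket_skew hcomp b (a + c) y _ hy (quotBracket_mem hcomp a c x _ hx hz'),
      quotBracket_skew hcomp a c x _ hx hz']
    obtain ⟨x, hx, rfl⟩ := hx
    obtain ⟨y, hy, rfl⟩ := hy
    have h : (D).mkQ _ = 0 :=
      (Submodule.Quotient.mk_eq_zero _).2 (cyclic_mem_DMN (aMN := aMN) (aNM := aNM) hx hy hz)
    simp only [map_add, map_zsmul, map_neg, LinearMap.neg_apply, LinearMap.smul_apply,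
      quotBracket_quotBracket, ssign_add_right] at h ⊢
    simp only [ssign_comm b a, ssign_comm c b] at h ⊢
    generalize (D).mkQ (M.bracket (φ x) (φ y) ⊗ₜ[K] ψ z) = u at h ⊢
    generalize (D).mkQ (M.bracket (φ y) (φ z) ⊗ₜ[K] ψ x) = v at h ⊢
    generalize (D).mkQ (M.bracket (φ z) (φ x) ⊗ₜ[K] ψ y) = w at h ⊢
    rcases ssign_eq_one_or a b with h1 | h1 <;> rcases ssign_eq_one_or a c with h2 | h2 <;>
      rcases ssign_eq_one_or b c with h3 | h3 <;>
      simp only [h1, h2, h3, one_smul, neg_smul, mul_one, mul_neg, neg_neg, smul_neg] at h ⊢ <;>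
      first
      | (refine sub_eq_zero.1 (Eq.trans ?_ h); abel1)
      | (refine sub_eq_zero.1 (Eq.trans ?_ (neg_eq_zero.2 h)); abel1)
  obtain ⟨z, rfl⟩ := (D).mkQ_surjective z
  exact LinearMap.congr_fun key z

lemma quotBracket_self (hcomp : AreCompatible aMN aNM) (x : M.carrier ⊗[K] N.carrier ⧸ D)
    (hx : x ∈ gradeQuot gr D 0) : quotBracket hcomp x x = 0 := by
  obtain ⟨x, hx, rfl⟩ := hx
  rw [quotBracket_mkQ, neg_eq_zero]
  exact (Submodule.Quotient.mk_eq_zero _).2 (self_mem_DMN hx)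

/-- The Lie superalgebra `(M ⊗ N) / D(M,N)`. -/
noncomputable def quotLie (hcomp : AreCompatible aMN aNM) : LieSuperalgebra K where
  carrier := M.carrier ⊗[K] N.carrier ⧸ D
  grading := gradeQuot gr D
  isInternal := isInternal_gradeQuot (tensorProj M.isInternal N.isInternal)
    (tensorProj_of_mem M.isInternal N.isInternal)
    (iSup_gradeTensor M.iSup_grading N.iSup_grading) _ DMN_le_comap_tensorProj
  bracket := quotBracket hcomp
  bracket_grading := quotBracket_mem hcomp
  super_skew := quotBracket_skew hcomp
  super_jacobi := quotBracket_jacobi hcomp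
  bracket_self_even := quotBracket_self hcomp

lemma quotBracket_tmul (hcomp : AreCompatible aMN aNM) {α β : ZMod 2} {m : M.carrier}
    {n : N.carrier} (hm : m ∈ M.grading α) (hn : n ∈ N.grading β) (m' : M.carrier)
    (n' : N.carrier) :
    quotBracket hcomp ((D).mkQ (m ⊗ₜ[K] n)) ((D).mkQ (m' ⊗ₜ[K] n'))
      = -(ssign α β • (D).mkQ (aNM.act n m ⊗ₜ[K] aMN.act m' n')) := by
  rw [quotBracket_mkQ, toLeft_tmul aNM hm hn, zsmul_tmul, map_zsmul, toRight_tmul]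

/-- The symbols `m ⊗ n` in `(M ⊗ N) / D(M,N)`. -/
noncomputable def quotTensorData (hcomp : AreCompatible aMN aNM) :
    TensorData aMN aNM (quotLie hcomp) where
  pair _ _ m n := (D).mkQ (m.1 ⊗ₜ[K] n.1)
  pair_grading _ _ m n := Submodule.mem_map_of_mem (f := (D).mkQ)
    (tmul_mem_gradeTensor m.2 n.2)
  pair_smul_left _ _ c m n := by
    change (D).mkQ ((c • m.1) ⊗ₜ[K] n.1) = c • (D).mkQ (m.1 ⊗ₜ[K] n.1)
    rw [← TensorProduct.smul_tmul', map_smul]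
  pair_smul_right _ _ c m n := by
    change (D).mkQ (m.1 ⊗ₜ[K] (c • n.1)) = c • (D).mkQ (m.1 ⊗ₜ[K] n.1)
    rw [TensorProduct.tmul_smul, map_smul]
  pair_add_left _ _ m m' n := by
    rw [Submodule.coe_add, TensorProduct.add_tmul, map_add]
    rfl
  pair_add_right _ _ m n n' := by
    rw [Submodule.coe_add, TensorProduct.tmul_add, map_add]
    rfl
  pair_bracket_left α α' β m m' n := by
    have h : (D).mkQ _ = 0 :=
      (Submodule.Quotient.mk_eq_zero _).2 (bracket_tmul_mem_DMN α α' β m m' n)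
    rw [map_add, map_sub, map_zsmul, sub_add] at h
    exact sub_eq_zero.1 h
  pair_bracket_right α β β' m n n' := by
    have h : (D).mkQ _ = 0 :=
      (Submodule.Quotient.mk_eq_zero _).2 (tmul_bracket_mem_DMN α β β' m n n')
    rw [map_add, map_sub, map_zsmul, map_zsmul, sub_add] at h
    exact sub_eq_zero.1 h
  pair_bracket_pair _ _ _ _ m n _ _ := quotBracket_tmul hcomp m.2 n.2 _ _

/-- The linear map out of `M ⊗ N` determined by tensor symbols in a Lie superalgebra. -/
noncomputable def TensorData.lift {Q : LieSuperalgebra K} (d : TensorData aMN aNM Q) :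
    M.carrier ⊗[K] N.carrier →ₗ[K] Q.carrier :=
  homLift M.isInternal N.isInternal fun α β =>
    LinearMap.mk₂ K (d.pair α β) (d.pair_add_left α β) (d.pair_smul_left α β)
      (d.pair_add_right α β) (fun c m n => d.pair_smul_right α β c m n)

section Lift

variable {Q : LieSuperalgebra K} (d : TensorData aMN aNM Q)

lemma TensorData.lift_tmul {α β : ZMod 2} {m : M.carrier} {n : N.carrier}
    (hm : m ∈ M.grading α) (hn : n ∈ N.grading β) :
    d.lift (m ⊗ₜ[K] n) = d.pair α β ⟨m, hm⟩ ⟨n, hn⟩ := by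
  rw [TensorData.lift, homLift_tmul _ _ _ hm hn]
  rfl

lemma TensorData.lift_mem {γ : ZMod 2} {x : M.carrier ⊗[K] N.carrier} (hx : x ∈ gr γ) :
    d.lift x ∈ Q.grading γ := by
  have hle : gr γ ≤ (Q.grading γ).comap d.lift := by
    refine gradeTensor_le ?_
    rintro α β rfl m hm n hn
    rw [Submodule.mem_comap, d.lift_tmul hm hn]
    exact d.pair_grading _ _ _ _
  exact hle hx

lemma TensorData.lift_toLeft_tmul_toRight (x y : M.carrier ⊗[K] N.carrier) :
    d.lift (φ x ⊗ₜ[K] ψ y) = -Q.bracket (d.lift x) (d.lift y) := by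
  have h : (preBracket aMN aNM).compr₂ d.lift = -Q.bracket.compl₁₂ d.lift d.lift := by
    refine ext_homogeneous fun α β m hm n hn => ext_homogeneous fun α' β' m' hm' n' hn' => ?_
    simp only [LinearMap.compr₂_apply, preBracket_apply, LinearMap.neg_apply,
      LinearMap.compl₁₂_apply]
    rw [toLeft_tmul aNM hm hn, zsmul_tmul, map_zsmul, toRight_tmul,
      d.lift_tmul (aNM.act_grading _ _ _ _ hn hm) (aMN.act_grading _ _ _ _ hm' hn'),
      d.lift_tmul hm hn, d.lift_tmul hm' hn', d.pair_bracket_pair, neg_neg]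
  exact LinearMap.congr_fun (LinearMap.congr_fun h x) y

lemma TensorData.DMN_le_ker_lift (hcomp : AreCompatible aMN aNM) : D ≤ LinearMap.ker d.lift := by
  have h3 : ∀ x y z : M.carrier ⊗[K] N.carrier,
      d.lift (M.bracket (φ x) (φ y) ⊗ₜ[K] ψ z)
        = Q.bracket (Q.bracket (d.lift x) (d.lift y)) (d.lift z) := by
    intro x y z
    rw [← toLeft_tmul_toRight hcomp, d.lift_toLeft_tmul_toRight, d.lift_toLeft_tmul_toRight]
    simp
  refine DMN_le ?_ ?_ ?_ ?_ ?_
  · intro α α' β m m' n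
    rw [LinearMap.mem_ker, map_add, map_sub, map_zsmul,
      d.lift_tmul (M.bracket_grading _ _ _ _ m.2 m'.2) n.2,
      d.lift_tmul m.2 (aMN.act_grading _ _ _ _ m'.2 n.2),
      d.lift_tmul m'.2 (aMN.act_grading _ _ _ _ m.2 n.2), d.pair_bracket_left]
    abel
  · intro α β β' m n n'
    rw [LinearMap.mem_ker, map_add, map_sub, map_zsmul, map_zsmul,
      d.lift_tmul m.2 (N.bracket_grading _ _ _ _ n.2 n'.2),
      d.lift_tmul (aNM.act_grading _ _ _ _ n'.2 m.2) n.2,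
      d.lift_tmul (aNM.act_grading _ _ _ _ n.2 m.2) n'.2, d.pair_bracket_right]
    abel
  · intro x hx _
    rw [LinearMap.mem_ker, d.lift_toLeft_tmul_toRight, Q.bracket_self_even _ (d.lift_mem hx),
      neg_zero]
  · intro a b x hx y hy
    rw [LinearMap.mem_ker, map_add, map_zsmul, d.lift_toLeft_tmul_toRight,
      d.lift_toLeft_tmul_toRight, Q.super_skew a b _ _ (d.lift_mem hx) (d.lift_mem hy)]
    simp
  · intro a b c x hx y hy z hz
    simp only [LinearMap.mem_ker, map_add, map_zsmul, h3]
    exact Q.cyclic_jacobi (d.lift_mem hx) (d.lift_mem hy) (d.lift_mem hz)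

/-- The homomorphism `(M ⊗ N) / D(M,N) → Q` determined by tensor symbols in `Q`. -/
noncomputable def TensorData.quotHom (hcomp : AreCompatible aMN aNM) :
    LieSuperHom (quotLie hcomp) Q where
  toLinear := (D).liftQ d.lift (d.DMN_le_ker_lift hcomp)
  map_grading := by
    rintro α _ ⟨x, hx, rfl⟩
    exact d.lift_mem hx
  map_bracket x y := by
    obtain ⟨x, rfl⟩ := (D).mkQ_surjective x
    obtain ⟨y, rfl⟩ := (D).mkQ_surjective y
    have := d.lift_toLeft_tmul_toRight x y
    exact (map_neg ((D).liftQ d.lift (d.DMN_le_ker_lift hcomp))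
      ((D).mkQ (φ x ⊗ₜ[K] ψ y))).trans ((congrArg Neg.neg this).trans (neg_neg _))

end Lift

end Relations

/-- The identity homomorphism. -/
def LieSuperHom.id (L : LieSuperalgebra K) : LieSuperHom L L where
  toLinear := LinearMap.id
  map_grading _ _ hx := hx
  map_bracket _ _ := rfl

/-- Composition of homomorphisms. -/
def LieSuperHom.comp {L L' L'' : LieSuperalgebra K} (g : LieSuperHom L' L'')
    (f : LieSuperHom L L') : LieSuperHom L L'' where
  toLinear := g.toLinear ∘ₗ f.toLinear
  map_grading α x hx := g.map_grading α _ (f.map_grading α x hx)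
  map_bracket x y := by simp [f.map_bracket, g.map_bracket]

end TensorQuotient

/-- For compatible actions of `M` and `N` on each other there is a natural
isomorphism of Lie superalgebras `M ⊗ N ≅ (M ⊗_K N) / D(M,N)`, where the Lie bracket of
the quotient is given on generators by `[m⊗n, m′⊗n′] = −(−1)^{|m||n|}(ⁿm ⊗ ^{m′}n′)`. -/
theorem statement1 {K : Type} [CommRing K] (M N : LieSuperalgebra K)
    (aMN : LieSuperAction M N) (aNM : LieSuperAction N M)
    (hcomp : AreCompatible aMN aNM)
    (T : LieSuperalgebra K) (ι : TensorData aMN aNM T) (hT : IsNATensor aMN aNM T ι) :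
    ∃ br : (M.carrier ⊗[K] N.carrier ⧸ DMN M N aMN aNM) →ₗ[K]
        (M.carrier ⊗[K] N.carrier ⧸ DMN M N aMN aNM) →ₗ[K]
        (M.carrier ⊗[K] N.carrier ⧸ DMN M N aMN aNM),
      -- the bracket is given on generators by the displayed formula
      (∀ (α β α' β' : ZMod 2) (m : M.grading α) (n : N.grading β)
          (m' : M.grading α') (n' : N.grading β'),
        br ((DMN M N aMN aNM).mkQ (m.1 ⊗ₜ[K] n.1))
            ((DMN M N aMN aNM).mkQ (m'.1 ⊗ₜ[K] n'.1))
          = -(ssign α β •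
              (DMN M N aMN aNM).mkQ ((aNM.act n.1 m.1) ⊗ₜ[K] (aMN.act m'.1 n'.1)))) ∧
      -- this bracket makes the quotient supermodule a Lie superalgebra:
      DirectSum.IsInternal (gradeQuot (gradeTensor M.grading N.grading) (DMN M N aMN aNM)) ∧
      (∀ (α β : ZMod 2) (x y : M.carrier ⊗[K] N.carrier ⧸ DMN M N aMN aNM),
        x ∈ gradeQuot (gradeTensor M.grading N.grading) (DMN M N aMN aNM) α →
        y ∈ gradeQuot (gradeTensor M.grading N.grading) (DMN M N aMN aNM) β →
        br x y ∈ gradeQuot (gradeTensor M.grading N.grading) (DMN M N aMN aNM) (α + β)) ∧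
      (∀ (α β : ZMod 2) (x y : M.carrier ⊗[K] N.carrier ⧸ DMN M N aMN aNM),
        x ∈ gradeQuot (gradeTensor M.grading N.grading) (DMN M N aMN aNM) α →
        y ∈ gradeQuot (gradeTensor M.grading N.grading) (DMN M N aMN aNM) β →
        br x y = -(ssign α β • br y x)) ∧
      (∀ (α β : ZMod 2) (x y : M.carrier ⊗[K] N.carrier ⧸ DMN M N aMN aNM),
        x ∈ gradeQuot (gradeTensor M.grading N.grading) (DMN M N aMN aNM) α →
        y ∈ gradeQuot (gradeTensor M.grading N.grading) (DMN M N aMN aNM) β →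
        ∀ z, br x (br y z) = br (br x y) z + ssign α β • br y (br x z)) ∧
      (∀ x ∈ gradeQuot (gradeTensor M.grading N.grading) (DMN M N aMN aNM) 0,
        br x x = 0) ∧
      -- and the canonical map `M ⊗ N → (M ⊗_K N)/D(M,N)` is an isomorphism of
      -- Lie superalgebras
      ∃ e : T.carrier ≃ₗ[K] (M.carrier ⊗[K] N.carrier ⧸ DMN M N aMN aNM),
        SuperEquiv T.grading
          (gradeQuot (gradeTensor M.grading N.grading) (DMN M N aMN aNM)) e ∧
        (∀ x y : T.carrier, e (T.bracket x y) = br (e x) (e y)) ∧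
        (∀ (α β : ZMod 2) (m : M.grading α) (n : N.grading β),
          e (ι.pair α β m n) = (DMN M N aMN aNM).mkQ (m.1 ⊗ₜ[K] n.1)) := by
  obtain ⟨f, hf, -⟩ := hT (quotLie hcomp) (quotTensorData hcomp)
  let g : LieSuperHom (quotLie hcomp) T := ι.quotHom hcomp
  have hg : ∀ (α β : ZMod 2) (m : M.grading α) (n : N.grading β),
      g.toLinear ((DMN M N aMN aNM).mkQ (m.1 ⊗ₜ[K] n.1)) = ι.pair α β m n :=
    fun α β m n => ι.lift_tmul m.2 n.2
  have hgf : g.toLinear ∘ₗ f.toLinear = LinearMap.id := by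
    have h : g.comp f = LieSuperHom.id T := by
      refine (hT T ι).unique (fun α β m n => ?_) (fun _ _ _ _ => rfl)
      exact (congrArg g.toLinear (hf α β m n)).trans (hg α β m n)
    exact congrArg LieSuperHom.toLinear h
  have hfg : f.toLinear ∘ₗ g.toLinear = LinearMap.id := by
    have h : (f.toLinear ∘ₗ g.toLinear) ∘ₗ (DMN M N aMN aNM).mkQ = (DMN M N aMN aNM).mkQ := by
      refine ext_homogeneous fun α β m hm n hn => ?_
      exact (congrArg f.toLinear (hg α β ⟨m, hm⟩ ⟨n, hn⟩)).trans (hf α β ⟨m, hm⟩ ⟨n, hn⟩)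
    refine LinearMap.ext fun x => ?_
    obtain ⟨x, rfl⟩ := (DMN M N aMN aNM).mkQ_surjective x
    exact LinearMap.congr_fun h x
  refine ⟨quotBracket hcomp, fun α β _ _ m n m' n' => quotBracket_tmul hcomp m.2 n.2 m'.1 n'.1,
    (quotLie hcomp).isInternal, quotBracket_mem hcomp, quotBracket_skew hcomp,
    quotBracket_jacobi hcomp, quotBracket_self hcomp,
    LinearEquiv.ofLinearMap f.toLinear g.toLinear hfg hgf, fun α => le_antisymm ?_ ?_,
    f.map_bracket, hf⟩
  · rintro _ ⟨x, hx, rfl⟩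
    exact f.map_grading α x hx
  · intro x hx
    exact ⟨g.toLinear x, g.map_grading α x hx, LinearMap.congr_fun hfg x⟩

end SuperNA
end

section
/- Let M and N be Lie superalgebras over a commutative unital ring K acting compatibly on each other, and let [M,N]^M ⊆ M and [M,N]^N ⊆ N denote the images of the homomorphisms μ : M ⊗ N → M, m ⊗ n ↦ −(−1)^{|m||n|}(ⁿm), and ν : M ⊗ N → N, m ⊗ n ↦ ᵐn. Then: (i) if [M,N]^M is nilpotent, then M ⊗ N and [M,N]^N are nilpotent, and cl([M,N]^M) ≤ cl(M ⊗ N) ≤ cl([M,N]^M) + 1 and cl([M,N]^N) ≤ cl([M,N]^M) + 1, where cl denotes nilpotency class; (ii) if [M,N]^M is solvable, then M ⊗ N and [M,N]^N are solvable, and ℓ([M,N]^M) ≤ ℓ(M ⊗ N) ≤ ℓ([M,N]^M) + 1 and ℓ([M,N]^N) ≤ ℓ([M,N]^M) + 1, where ℓ denotes derived length; (iii) if [M,N]^M is n-Engel, then M ⊗ N and [M,N]^N are (n+1)-Engel. -/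
open scoped TensorProduct

namespace SuperNA

variable {K : Type} [CommRing K]

theorem univ_zmod_two : (Set.univ : Set (ZMod 2)) = {0, 1} :=
  (Set.eq_univ_of_forall (by decide : ∀ i : ZMod 2, i = 0 ∨ i = 1)).symm

theorem LieSuperalgebra.isCompl_grading (L : LieSuperalgebra K) :
    IsCompl (L.grading 0) (L.grading 1) :=
  L.isInternal.isCompl (by decide) univ_zmod_two

theorem LieSuperalgebra.exists_homogeneous_add (L : LieSuperalgebra K) (x : L.carrier) :
    ∃ x₀ ∈ L.grading 0, ∃ x₁ ∈ L.grading 1, x₀ + x₁ = x :=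
  Submodule.mem_sup.1 (L.isCompl_grading.sup_eq_top ▸ Submodule.mem_top)

/-- A bracket-closed submodule spanned by homogeneous elements, as a Lie superalgebra. -/
def LieSuperalgebra.homogeneousSub (L : LieSuperalgebra K) (s : Set L.carrier)
    (hs : ∀ x ∈ s, ∃ α, x ∈ L.grading α)
    (hbr : ∀ x ∈ Submodule.span K s, ∀ y ∈ Submodule.span K s,
      L.bracket x y ∈ Submodule.span K s) : LieSuperalgebra K where
  carrier := Submodule.span K s
  grading := gradeSub L.grading (Submodule.span K s)
  isInternal := by
    rw [DirectSum.isInternal_submodule_iff_isCompl (i := 0) (j := 1) _ (by decide)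
      univ_zmod_two]
    constructor
    · rw [Submodule.disjoint_def]
      intro x h0 h1
      exact Subtype.ext (Submodule.disjoint_def.1 L.isCompl_grading.disjoint x.1 h0 h1)
    · rw [codisjoint_iff, eq_top_iff]
      rintro ⟨x, hx⟩ -
      induction hx using Submodule.span_induction with
      | mem x hx =>
        obtain ⟨α, hα⟩ := hs x hx
        fin_cases α
        · exact Submodule.mem_sup_left hα
        · exact Submodule.mem_sup_right hα
      | zero => exact Submodule.zero_mem _
      | add x y hx hy ihx ihy => exact Submodule.add_mem _ ihx ihy
      | smul c x hx ih => exact Submodule.smul_mem _ c ih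
  bracket := LinearMap.mk₂ K (fun x y => ⟨L.bracket x.1 y.1, hbr x.1 x.2 y.1 y.2⟩)
    (fun x x' y => Subtype.ext (by simp)) (fun c x y => Subtype.ext (by simp))
    (fun x y y' => Subtype.ext (by simp)) (fun c x y => Subtype.ext (by simp))
  bracket_grading α β x y hx hy := L.bracket_grading α β x.1 y.1 hx hy
  super_skew α β x y hx hy := Subtype.ext (L.super_skew α β x.1 y.1 hx hy)
  super_jacobi α β x y hx hy z := Subtype.ext (L.super_jacobi α β x.1 y.1 hx hy z.1)
  bracket_self_even x hx := Subtype.ext (L.bracket_self_even x.1 hx)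

section Tensor

variable {M N T : LieSuperalgebra K} {aMN : LieSuperAction M N} {aNM : LieSuperAction N M}

/-- The set of tensor symbols. -/
def TensorData.symbols (ι : TensorData aMN aNM T) : Set T.carrier :=
  {t | ∃ (α β : ZMod 2) (m : M.grading α) (n : N.grading β), t = ι.pair α β m n}

theorem TensorData.bracket_mem_span_symbols (ι : TensorData aMN aNM T) :
    ∀ x ∈ Submodule.span K ι.symbols, ∀ y ∈ Submodule.span K ι.symbols,
      T.bracket x y ∈ Submodule.span K ι.symbols := by
  intro x hx y hy
  induction hx, hy using Submodule.span_induction₂ with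
  | mem_mem x y hx hy =>
    obtain ⟨α, β, m, n, rfl⟩ := hx
    obtain ⟨α', β', m', n', rfl⟩ := hy
    rw [ι.pair_bracket_pair]
    refine Submodule.neg_mem _ (zsmul_mem (Submodule.subset_span ?_) _)
    exact ⟨_, _, _, _, rfl⟩
  | zero_left y hy => simp
  | zero_right x hx => simp
  | add_left x y z hx hy hz h₁ h₂ => simpa using Submodule.add_mem _ h₁ h₂
  | add_right x y z hx hy hz h₁ h₂ => simpa using Submodule.add_mem _ h₁ h₂
  | smul_left r x y hx hy h => simpa using Submodule.smul_mem _ r h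
  | smul_right r x y hx hy h => simpa using Submodule.smul_mem _ r h

/-- The Lie sub-superalgebra spanned by the tensor symbols. -/
def TensorData.spanSub (ι : TensorData aMN aNM T) : LieSuperalgebra K :=
  T.homogeneousSub ι.symbols
    (by rintro _ ⟨α, β, m, n, rfl⟩; exact ⟨_, ι.pair_grading α β m n⟩)
    ι.bracket_mem_span_symbols

/-- The tensor symbols, viewed in the Lie sub-superalgebra they span. -/
def TensorData.toSpanSub (ι : TensorData aMN aNM T) : TensorData aMN aNM ι.spanSub where
  pair α β m n :=
    (⟨ι.pair α β m n, Submodule.subset_span ⟨_, _, _, _, rfl⟩⟩ : Submodule.span K ι.symbols)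
  pair_grading := ι.pair_grading
  pair_smul_left α β c m n := Subtype.ext (ι.pair_smul_left α β c m n)
  pair_smul_right α β c m n := Subtype.ext (ι.pair_smul_right α β c m n)
  pair_add_left α β m m' n := Subtype.ext (ι.pair_add_left α β m m' n)
  pair_add_right α β m n n' := Subtype.ext (ι.pair_add_right α β m n n')
  pair_bracket_left α α' β m m' n := Subtype.ext (ι.pair_bracket_left α α' β m m' n)
  pair_bracket_right α β β' m n n' := Subtype.ext (ι.pair_bracket_right α β β' m n n')
  pair_bracket_pair α β α' β' m n m' n' :=
    Subtype.ext (ι.pair_bracket_pair α β α' β' m n m' n')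

theorem IsNATensor.span_symbols {ι : TensorData aMN aNM T} (hT : IsNATensor aMN aNM T ι) :
    Submodule.span K ι.symbols = ⊤ := by
  obtain ⟨f, hf, -⟩ := hT ι.spanSub ι.toSpanSub
  let g : LieSuperHom T T :=
    { toLinear := (Submodule.span K ι.symbols).subtype ∘ₗ f.toLinear
      map_grading := fun α x hx => f.map_grading α x hx
      map_bracket := fun x y => congrArg Subtype.val (f.map_bracket x y) }
  let i : LieSuperHom T T :=
    { toLinear := LinearMap.id
      map_grading := fun α x hx => hx
      map_bracket := fun x y => rfl }
  have hgi : g = i := (hT T ι).unique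
    (fun α β m n => congrArg Subtype.val (hf α β m n)) (fun α β m n => rfl)
  rw [eq_top_iff]
  intro x _
  have hx : g.toLinear x = x := by rw [hgi]; rfl
  rw [← hx]
  exact (f.toLinear x).2

/-- Tensoring with a fixed homogeneous element of `N`, as a linear map on all of `M`. -/
noncomputable def TensorData.tensorRight (ι : TensorData aMN aNM T) {β : ZMod 2}
    (n : N.grading β) : M.carrier →ₗ[K] T.carrier :=
  DirectSum.toModule K (ZMod 2) T.carrier (fun α =>
    { toFun := fun m => ι.pair α β m n
      map_add' := fun m m' => ι.pair_add_left α β m m' n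
      map_smul' := fun c m => ι.pair_smul_left α β c m n }) ∘ₗ
    (LinearEquiv.ofBijective (DirectSum.coeLinearMap M.grading) M.isInternal).symm.toLinearMap

theorem TensorData.tensorRight_apply (ι : TensorData aMN aNM T) {α β : ZMod 2}
    (m : M.grading α) (n : N.grading β) : ι.tensorRight n m.1 = ι.pair α β m n := by
  have h : (LinearEquiv.ofBijective (DirectSum.coeLinearMap M.grading) M.isInternal).symm m.1
      = DirectSum.lof K (ZMod 2) (fun α => M.grading α) α m := by
    rw [LinearEquiv.symm_apply_eq]
    exact (DirectSum.coeLinearMap_lof M.grading α m).symm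
  rw [TensorData.tensorRight, LinearMap.comp_apply, LinearEquiv.coe_coe, h,
    DirectSum.toModule_lof]
  rfl

variable {ι : TensorData aMN aNM T} {μ : LieSuperHom T M}

theorem IsNATensor.bracket_pair (hT : IsNATensor aMN aNM T ι)
    (hμ : ∀ (α β : ZMod 2) (m : M.grading α) (n : N.grading β),
      μ.toLinear (ι.pair α β m n) = -(ssign α β • aNM.act n.1 m.1))
    {α β : ZMod 2} (m : M.grading α) (n : N.grading β) (z : T.carrier) :
    T.bracket z (ι.pair α β m n) =
      ι.tensorRight ⟨aMN.act m.1 n.1, aMN.act_grading α β m.1 n.1 m.2 n.2⟩ (μ.toLinear z) := by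
  have hz : z ∈ Submodule.span K ι.symbols := hT.span_symbols ▸ Submodule.mem_top
  induction hz using Submodule.span_induction with
  | mem z hz =>
    obtain ⟨α', β', m', n', rfl⟩ := hz
    rw [ι.pair_bracket_pair, hμ, map_neg, map_zsmul, ← ι.tensorRight_apply]
  | zero => simp
  | add x y hx hy ihx ihy => simp [ihx, ihy]
  | smul c x hx ih => simp [ih]

theorem IsNATensor.bracket_eq_zero_of_left (hT : IsNATensor aMN aNM T ι)
    (hμ : ∀ (α β : ZMod 2) (m : M.grading α) (n : N.grading β),
      μ.toLinear (ι.pair α β m n) = -(ssign α β • aNM.act n.1 m.1))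
    {z : T.carrier} (hz : μ.toLinear z = 0) (y : T.carrier) : T.bracket z y = 0 := by
  have hy : y ∈ Submodule.span K ι.symbols := hT.span_symbols ▸ Submodule.mem_top
  induction hy using Submodule.span_induction with
  | mem y hy =>
    obtain ⟨α, β, m, n, rfl⟩ := hy
    rw [hT.bracket_pair hμ, hz, map_zero]
  | zero => simp
  | add x y hx hy ihx ihy => simp [ihx, ihy]
  | smul c x hx ih => simp [ih]

end Tensor

theorem LieSuperHom.ker_homogeneous {L M : LieSuperalgebra K} (f : LieSuperHom L M)
    {x₀ x₁ : L.carrier} (h₀ : x₀ ∈ L.grading 0) (h₁ : x₁ ∈ L.grading 1)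
    (h : f.toLinear (x₀ + x₁) = 0) : f.toLinear x₀ = 0 ∧ f.toLinear x₁ = 0 := by
  rw [map_add] at h
  have h' : f.toLinear x₀ = 0 := by
    refine Submodule.disjoint_def.1 M.isCompl_grading.disjoint _ (f.map_grading 0 _ h₀) ?_
    rw [eq_neg_of_add_eq_zero_left h]
    exact Submodule.neg_mem _ (f.map_grading 1 _ h₁)
  exact ⟨h', by simpa [h'] using h⟩

/-- An even kernel that annihilates on the left also annihilates on the right. -/
theorem LieSuperHom.bracket_eq_zero_of_right {L M : LieSuperalgebra K} (f : LieSuperHom L M)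
    (hf : ∀ z, f.toLinear z = 0 → ∀ y, L.bracket z y = 0)
    {z : L.carrier} (hz : f.toLinear z = 0) (y : L.carrier) : L.bracket y z = 0 := by
  obtain ⟨y₀, hy₀, y₁, hy₁, rfl⟩ := L.exists_homogeneous_add y
  obtain ⟨z₀, hz₀, z₁, hz₁, rfl⟩ := L.exists_homogeneous_add z
  obtain ⟨k₀, k₁⟩ := f.ker_homogeneous hz₀ hz₁ hz
  simp [L.super_skew _ _ _ _ hy₀ hz₀, L.super_skew _ _ _ _ hy₀ hz₁,
    L.super_skew _ _ _ _ hy₁ hz₀, L.super_skew _ _ _ _ hy₁ hz₁, hf _ k₀, hf _ k₁]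

section Series

variable {L M : LieSuperalgebra K} (f : LieSuperHom L M)

theorem LieSuperHom.map_bracketSpan (S S' : Submodule K L.carrier) :
    (bracketSpan L S S').map f.toLinear =
      bracketSpan M (S.map f.toLinear) (S'.map f.toLinear) := by
  rw [bracketSpan, bracketSpan, Submodule.map_span]
  congr 1
  ext z
  constructor
  · rintro ⟨_, ⟨x, hx, y, hy, rfl⟩, rfl⟩
    exact ⟨_, ⟨x, hx, rfl⟩, _, ⟨y, hy, rfl⟩, f.map_bracket x y⟩
  · rintro ⟨_, ⟨x, hx, rfl⟩, _, ⟨y, hy, rfl⟩, rfl⟩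
    exact ⟨_, ⟨x, hx, y, hy, rfl⟩, f.map_bracket x y⟩

theorem LieSuperHom.map_lcs (S : Submodule K L.carrier) (c : ℕ) :
    (lcs L S c).map f.toLinear = lcs M (S.map f.toLinear) c := by
  induction c with
  | zero => rfl
  | succ c ih => rw [lcs, lcs, f.map_bracketSpan, ih]

theorem LieSuperHom.map_ds (S : Submodule K L.carrier) (c : ℕ) :
    (ds L S c).map f.toLinear = ds M (S.map f.toLinear) c := by
  induction c with
  | zero => rfl
  | succ c ih => rw [ds, ds, f.map_bracketSpan, ih]

theorem LieSuperHom.lcs_range (c : ℕ) :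
    lcs M (LinearMap.range f.toLinear) c = (lcs L ⊤ c).map f.toLinear := by
  rw [f.map_lcs, Submodule.map_top]

theorem LieSuperHom.ds_range (c : ℕ) :
    ds M (LinearMap.range f.toLinear) c = (ds L ⊤ c).map f.toLinear := by
  rw [f.map_ds, Submodule.map_top]

theorem LieSuperHom.map_bracket_pow (x y : L.carrier) (n : ℕ) :
    f.toLinear ((L.bracket x ^ n) y) = (M.bracket (f.toLinear x) ^ n) (f.toLinear y) := by
  induction n with
  | zero => rfl
  | succ n ih => rw [pow_succ', pow_succ', Module.End.mul_apply, Module.End.mul_apply,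
      f.map_bracket, ih]

theorem LieSuperHom.isEngel_range {n : ℕ} (h : IsEngel L ⊤ n) :
    IsEngel M (LinearMap.range f.toLinear) n := by
  rintro _ ⟨x, rfl⟩ _ ⟨y, rfl⟩
  rw [← f.map_bracket_pow, h x trivial y trivial, map_zero]


theorem LieSuperHom.bracketSpan_eq_bot (hf : ∀ z, f.toLinear z = 0 → ∀ y, L.bracket y z = 0)
    (S : Submodule K L.carrier)
    {S' : Submodule K L.carrier} (h : S'.map f.toLinear = ⊥) : bracketSpan L S S' = ⊥ := by
  rw [bracketSpan, Submodule.span_eq_bot]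
  rintro _ ⟨x, -, y, hy, rfl⟩
  exact hf y (LinearMap.le_ker_iff_map.2 h hy) x

end Series

/-- Nilpotency, solvability and Engel conditions for the non-abelian
tensor product.  Here `[M,N]^M = Im μ` and `[M,N]^N = Im ν`; nilpotency of class `≤ c`
of a subalgebra `S` is encoded as `lcs S c = ⊥`, solvability of derived length `≤ c`
as `ds S c = ⊥`, and inequalities between classes/lengths are encoded accordingly. -/
theorem statement7 {K : Type} [CommRing K] (M N : LieSuperalgebra K)
    (aMN : LieSuperAction M N) (aNM : LieSuperAction N M)
    (hcomp : AreCompatible aMN aNM)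
    (T : LieSuperalgebra K) (ι : TensorData aMN aNM T) (hT : IsNATensor aMN aNM T ι)
    (μ : LieSuperHom T M) (ν : LieSuperHom T N)
    (hμ : ∀ (α β : ZMod 2) (m : M.grading α) (n : N.grading β),
      μ.toLinear (ι.pair α β m n) = -(ssign α β • aNM.act n.1 m.1))
    (hν : ∀ (α β : ZMod 2) (m : M.grading α) (n : N.grading β),
      ν.toLinear (ι.pair α β m n) = aMN.act m.1 n.1) :
    -- (i) nilpotency
    (((∃ c, lcs M (LinearMap.range μ.toLinear) c = ⊥) →
        (∃ c, lcs T ⊤ c = ⊥) ∧ (∃ c, lcs N (LinearMap.range ν.toLinear) c = ⊥)) ∧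
      -- class([M,N]^M) ≤ class(M ⊗ N)
      (∀ c, lcs T ⊤ c = ⊥ → lcs M (LinearMap.range μ.toLinear) c = ⊥) ∧
      -- class(M ⊗ N) ≤ class([M,N]^M) + 1
      (∀ c, lcs M (LinearMap.range μ.toLinear) c = ⊥ → lcs T ⊤ (c + 1) = ⊥) ∧
      -- class([M,N]^N) ≤ class([M,N]^M) + 1
      (∀ c, lcs M (LinearMap.range μ.toLinear) c = ⊥ →
        lcs N (LinearMap.range ν.toLinear) (c + 1) = ⊥)) ∧
    -- (ii) solvability
    (((∃ c, ds M (LinearMap.range μ.toLinear) c = ⊥) →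
        (∃ c, ds T ⊤ c = ⊥) ∧ (∃ c, ds N (LinearMap.range ν.toLinear) c = ⊥)) ∧
      -- ℓ([M,N]^M) ≤ ℓ(M ⊗ N)
      (∀ c, ds T ⊤ c = ⊥ → ds M (LinearMap.range μ.toLinear) c = ⊥) ∧
      -- ℓ(M ⊗ N) ≤ ℓ([M,N]^M) + 1
      (∀ c, ds M (LinearMap.range μ.toLinear) c = ⊥ → ds T ⊤ (c + 1) = ⊥) ∧
      -- ℓ([M,N]^N) ≤ ℓ([M,N]^M) + 1
      (∀ c, ds M (LinearMap.range μ.toLinear) c = ⊥ →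
        ds N (LinearMap.range ν.toLinear) (c + 1) = ⊥)) ∧
    -- (iii) Engel: if [M,N]^M is n-Engel then M ⊗ N and [M,N]^N are (n+1)-Engel
    (∀ n : ℕ, IsEngel M (LinearMap.range μ.toLinear) n →
      IsEngel T ⊤ (n + 1) ∧ IsEngel N (LinearMap.range ν.toLinear) (n + 1)) := by
  have hker : ∀ z, μ.toLinear z = 0 → ∀ y, T.bracket y z = 0 := fun z hz y =>
    μ.bracket_eq_zero_of_right (fun z hz y => hT.bracket_eq_zero_of_left hμ hz y) hz y
  have hlT : ∀ c, lcs M (LinearMap.range μ.toLinear) c = ⊥ → lcs T ⊤ (c + 1) = ⊥ :=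
    fun c h => μ.bracketSpan_eq_bot hker _ (by rw [← μ.lcs_range, h])
  have hdT : ∀ c, ds M (LinearMap.range μ.toLinear) c = ⊥ → ds T ⊤ (c + 1) = ⊥ :=
    fun c h => μ.bracketSpan_eq_bot hker _ (by rw [← μ.ds_range, h])
  have hlN : ∀ c, lcs M (LinearMap.range μ.toLinear) c = ⊥ →
      lcs N (LinearMap.range ν.toLinear) (c + 1) = ⊥ :=
    fun c h => by rw [ν.lcs_range, hlT c h, Submodule.map_bot]
  have hdN : ∀ c, ds M (LinearMap.range μ.toLinear) c = ⊥ →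
      ds N (LinearMap.range ν.toLinear) (c + 1) = ⊥ :=
    fun c h => by rw [ν.ds_range, hdT c h, Submodule.map_bot]
  refine ⟨⟨fun ⟨c, h⟩ => ⟨⟨_, hlT c h⟩, _, hlN c h⟩,
    fun c h => by rw [μ.lcs_range, h, Submodule.map_bot], hlT, hlN⟩,
    ⟨fun ⟨c, h⟩ => ⟨⟨_, hdT c h⟩, _, hdN c h⟩,
    fun c h => by rw [μ.ds_range, h, Submodule.map_bot], hdT, hdN⟩, fun n h => ?_⟩
  have hET : IsEngel T ⊤ (n + 1) := by
    intro x _ y _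
    rw [pow_succ', Module.End.mul_apply]
    refine hker _ ?_ x
    rw [μ.map_bracket_pow]
    exact h _ ⟨x, rfl⟩ _ ⟨y, rfl⟩
  exact ⟨hET, ν.isEngel_range hET⟩

end SuperNA
end
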